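/- Let q ≥ 3, Y ≥ 3, and let χ be a nonprincipal Dirichlet character mod q. Let 1/2 ≤ σ₀ < 1 and suppose the rectangle {z : σ₀ < Re z ≤ 1, |Im z| ≤ Y + 2} contains no zeros of L(z, χ). Then for σ ∈ (σ₀, 1] and σ₁ ∈ (σ₀, σ), one has −L'/L(σ, χ) = ∑_{n ≤ Y} Λ(n)χ(n)/n^σ + O((log q/(σ₁ − σ₀)) · Y^{σ₁ − σ} · log(Y/(σ − σ₁))), with an absolute implied constant. -/

import Mathlib

namespace LDA
open Complex Metric

/-- Blaschke bound: for a factorisation of `f` by zeros in a small disc. -/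
lemma blaschke_bound {R₁ R : ℝ} (hR₁ : 0 < R₁) (hR : R₁ < R) {f g : ℂ → ℂ} (hg : Differentiable ℂ g)
    {M : ℝ} (hM : ∀ z, ‖z‖ ≤ R → ‖f z‖ ≤ M * ‖f 0‖)
    {N : ℕ} (ρ : Fin N → ℂ) (hρ : ∀ i, ‖ρ i‖ ≤ R₁) (hfac : ∀ z, f z = (∏ i, (z - ρ i)) * g z) :
    (∀ z, ‖z‖ ≤ R → ‖g z * ∏ i, ((R ^ 2 - (starRingEnd ℂ) (ρ i) * z) / R)‖ ≤ M * ‖f 0‖) ∧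
    ‖f 0‖ * (R / R₁) ^ N ≤ ‖g 0 * ∏ i, ((R ^ 2 - (starRingEnd ℂ) (ρ i) * 0) / R)‖ := by
  have hR0 : 0 < R := hR₁.trans hR
  constructor
  · intro z hz
    have hd : Differentiable ℂ (fun z => g z * ∏ i, (((R:ℂ) ^ 2 - (starRingEnd ℂ) (ρ i) * z) / R)) := by
      fun_prop
    refine Complex.norm_le_of_forall_mem_frontier_norm_le (U := ball 0 R) isBounded_ball
      (hd.diffContOnCl) ?_ (z := z) ?_
    · intro z hz
      rw [frontier_ball _ hR0.ne'] at hz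
      have hz' : ‖z‖ = R := by simpa using hz
      have := hM z hz'.le
      rw [hfac z] at this
      convert this using 1
      rw [norm_mul, norm_mul, mul_comm, norm_prod, norm_prod]
      congr 1
      refine Finset.prod_congr rfl fun i _ => ?_
      have h1 : ((R:ℂ) ^ 2 - (starRingEnd ℂ) (ρ i) * z) = z * (starRingEnd ℂ) (z - ρ i) := by
        rw [map_sub, mul_sub, Complex.mul_conj, Complex.normSq_eq_norm_sq, hz']
        push_cast; ring
      rw [h1, norm_div, norm_mul, hz', RCLike.norm_conj]
      simp [abs_of_pos hR0, hR0.ne']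
    · rw [closure_ball _ hR0.ne']; simpa using hz
  · rw [hfac 0]
    simp only [norm_mul, norm_prod, mul_zero, sub_zero, zero_sub, norm_neg]
    have h2 : ∀ i : Fin N, ‖((R:ℂ)^2 / R)‖ = R := by
      intro i
      rw [pow_two, mul_div_assoc, div_self (by exact_mod_cast hR0.ne'), mul_one]
      simp [abs_of_pos hR0]
    rw [Finset.prod_congr rfl (fun i _ => h2 i)]
    rw [Finset.prod_const, Finset.card_univ, Fintype.card_fin, div_pow]
    have h3 : ∏ i, ‖ρ i‖ ≤ R₁ ^ N := by
      calc _ ≤ ∏ i : Fin N, R₁ := Finset.prod_le_prod (fun i _ => norm_nonneg _) (fun i _ => hρ i)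
        _ = _ := by simp
    have h4 : (∏ i, ‖ρ i‖) / R₁ ^ N ≤ 1 := by
      rw [div_le_one (by positivity)]; exact h3
    calc _ = ((∏ i, ‖ρ i‖) / R₁ ^ N) * (‖g 0‖ * R ^ N) := by ring
      _ ≤ 1 * (‖g 0‖ * R ^ N) := by gcongr
      _ = _ := by ring

lemma exists_factor {R₁ R : ℝ} (hR₁ : 0 < R₁) (hR : R₁ < R) {f : ℂ → ℂ} (hf : Differentiable ℂ f)
    (hf0 : f 0 ≠ 0) {M : ℝ} (hM : ∀ z, ‖z‖ ≤ R → ‖f z‖ ≤ M * ‖f 0‖) :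
    ∃ (N : ℕ) (ρ : Fin N → ℂ) (g : ℂ → ℂ), Differentiable ℂ g ∧ (∀ i, ‖ρ i‖ ≤ R₁) ∧
      (∀ z, f z = (∏ i, (z - ρ i)) * g z) ∧ (∀ z, ‖z‖ ≤ R₁ → g z ≠ 0) := by
  let P : ℕ → Prop := fun N => ∃ (ρ : Fin N → ℂ) (g : ℂ → ℂ), Differentiable ℂ g ∧
    (∀ i, ‖ρ i‖ ≤ R₁) ∧ (∀ z, f z = (∏ i, (z - ρ i)) * g z)
  have hP0 : P 0 := ⟨fun i => i.elim0, f, hf, fun i => i.elim0, fun z => by simp⟩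
  have hq : 1 < R / R₁ := by rwa [lt_div_iff₀ hR₁, one_mul]
  obtain ⟨B, hB⟩ := pow_unbounded_of_one_lt M hq
  have hbd : ∀ N, P N → N ≤ B := by
    rintro N ⟨ρ, g, hg, hρ, hfac⟩
    obtain ⟨h1, h2⟩ := blaschke_bound hR₁ hR hg hM ρ hρ hfac
    have h3 := h2.trans (h1 0 (by simpa using (hR₁.trans hR).le))
    have h4 : (R / R₁) ^ N ≤ M := by
      have : 0 < ‖f 0‖ := norm_pos_iff.mpr hf0
      nlinarith
    exact (pow_lt_pow_iff_right₀ hq).mp (h4.trans_lt hB) |>.le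
  classical
  obtain ⟨ρ, g, hg, hρ, hfac⟩ : P (Nat.findGreatest P B) := Nat.findGreatest_spec (Nat.zero_le _) hP0
  refine ⟨_, ρ, g, hg, hρ, hfac, ?_⟩
  intro z hz hgz
  have : P (Nat.findGreatest P B + 1) := by
    refine ⟨Fin.cons z ρ, dslope g z, ?_, ?_, ?_⟩
    · rw [← differentiableOn_univ] at hg ⊢
      exact (Complex.differentiableOn_dslope Filter.univ_mem).mpr hg
    · intro i
      refine Fin.cases ?_ (fun j => ?_) i
      · simpa using hz
      · simpa using hρ j
    · intro y
      rw [hfac y, Fin.prod_univ_succ]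
      simp only [Fin.cons_zero, Fin.cons_succ]
      have := sub_smul_dslope g z y
      rw [hgz, sub_zero, smul_eq_mul] at this
      rw [← this]; ring
  have h5 := Nat.le_findGreatest (hbd _ this) this
  omega

lemma local_fact {r R₁ R : ℝ} (hr : 0 < r) (hrR : r < R₁) (hR : R₁ < R) :
    ∃ C : ℝ, 0 < C ∧ ∀ (f : ℂ → ℂ) (M : ℝ), Differentiable ℂ f → 1 ≤ Real.log M → 0 < M → f 0 ≠ 0 →
      (∀ z, ‖z‖ ≤ R → ‖f z‖ ≤ M * ‖f 0‖) →
      ∃ (N : ℕ) (ρ : Fin N → ℂ) (φ : ℂ → ℂ), (N : ℝ) ≤ C * Real.log M ∧ (∀ i, f (ρ i) = 0) ∧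
        DifferentiableOn ℂ φ (ball 0 r) ∧ (∀ z ∈ ball 0 r, ‖φ z‖ ≤ C * Real.log M) ∧
        ∀ z ∈ ball 0 r, f z ≠ 0 → deriv f z / f z = φ z + ∑ i, 1 / (z - ρ i) := by
  have hR₁ : 0 < R₁ := hr.trans hrR
  have hR0 : 0 < R := hR₁.trans hR
  have hq : 1 < R / R₁ := by rwa [lt_div_iff₀ hR₁, one_mul]
  have hlq : 0 < Real.log (R / R₁) := Real.log_pos hq
  set δ := (R₁ - r) / 2 with hδ
  have hδ0 : 0 < δ := by rw [hδ]; linarith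
  set C₁ := 1 / Real.log (R / R₁) with hC₁
  set C₂ := (2 * R₁ / δ) / δ with hC₂
  set C₃ := R₁ / (R ^ 2 - R₁ * R₁) with hC₃
  have hden : 0 < R ^ 2 - R₁ * R₁ := by nlinarith
  have hC₁0 : 0 < C₁ := by positivity
  have hC₂0 : 0 < C₂ := by positivity
  have hC₃0 : 0 < C₃ := by positivity
  refine ⟨C₁ + C₂ + C₁ * C₃, by positivity, ?_⟩
  intro f M hf hlM hM0 hf0 hM
  obtain ⟨N, ρ, g, hg, hρ, hfac, hgne⟩ := exists_factor hR₁ hR hf hf0 hM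
  obtain ⟨h1, h2⟩ := blaschke_bound hR₁ hR hg hM ρ hρ hfac
  set h : ℂ → ℂ := fun z => g z * ∏ i, (((R:ℂ) ^ 2 - (starRingEnd ℂ) (ρ i) * z) / R) with hh
  change ∀ z, ‖z‖ ≤ R → ‖h z‖ ≤ _ at h1
  change _ ≤ ‖h 0‖ at h2
  have hf0' : 0 < ‖f 0‖ := norm_pos_iff.mpr hf0
  have hNpow : (R / R₁) ^ N ≤ M := by
    have := h2.trans (h1 0 (by simpa using hR0.le))
    nlinarith
  have hN : (N : ℝ) ≤ C₁ * Real.log M := by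
    have := Real.log_le_log (by positivity) hNpow
    rw [Real.log_pow] at this
    rw [hC₁, one_div, ← div_eq_inv_mul, le_div_iff₀ hlq]; exact this
  have hhd : Differentiable ℂ h := by rw [hh]; fun_prop
  have hfacne : ∀ i, ∀ z : ℂ, ‖z‖ ≤ R₁ → R ^ 2 - R₁ * R₁ ≤ ‖(R:ℂ) ^ 2 - (starRingEnd ℂ) (ρ i) * z‖ := by
    intro i z hz
    have h3 : ‖(R:ℂ)^2‖ = R ^ 2 := by simp
    have h4 : ‖(starRingEnd ℂ) (ρ i) * z‖ ≤ R₁ * R₁ := by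
      rw [norm_mul, RCLike.norm_conj]
      exact mul_le_mul (hρ i) hz (norm_nonneg _) hR₁.le
    have := norm_sub_norm_le ((R:ℂ)^2) ((starRingEnd ℂ) (ρ i) * z)
    linarith
  have hfacne' : ∀ i, ∀ z : ℂ, ‖z‖ ≤ R₁ → (R:ℂ) ^ 2 - (starRingEnd ℂ) (ρ i) * z ≠ 0 := by
    intro i z hz h0
    have := hfacne i z hz
    rw [h0, norm_zero] at this
    linarith
  have hRc : (R:ℂ) ≠ 0 := by exact_mod_cast hR0.ne'
  have hhne : ∀ z, ‖z‖ ≤ R₁ → h z ≠ 0 := by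
    intro z hz
    refine mul_ne_zero (hgne z hz) (Finset.prod_ne_zero_iff.mpr fun i _ => ?_)
    exact div_ne_zero (hfacne' i z hz) hRc
  -- logarithm
  have hdiv : DifferentiableOn ℂ (fun z => deriv h z / h z) (ball 0 R₁) := by
    intro z hz
    have hz' : ‖z‖ ≤ R₁ := by simpa using (mem_ball.mp hz).le
    exact ((hhd.deriv z).div (hhd z) (hhne z hz')).differentiableWithinAt
  obtain ⟨L, hL0, hL⟩ := (hdiv.isExactOn_ball).with_val_at 0 0
  have hexp : ∀ z ∈ ball (0:ℂ) R₁, h z = h 0 * Complex.exp (L z) := by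
    have hconst : ∀ z ∈ ball (0:ℂ) R₁, h z * Complex.exp (-L z) = h 0 * Complex.exp (-L 0) := by
      intro z hz
      refine (convex_ball (0:ℂ) R₁).is_const_of_fderivWithin_eq_zero (𝕜 := ℂ)
        (f := fun z => h z * Complex.exp (-L z)) ?_ ?_ hz (mem_ball_self hR₁)
      · intro y hy
        exact ((hhd y).mul ((hL y hy).differentiableAt.neg.cexp)).differentiableWithinAt
      · intro y hy
        have hy' : ‖y‖ ≤ R₁ := by simpa using (mem_ball.mp hy).le
        have hd1 : HasDerivAt (fun z => h z * Complex.exp (-L z)) 0 y := by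
          have := (hhd y).hasDerivAt.mul ((hL y hy).neg.cexp)
          have hk : h y * (deriv h y / h y) = deriv h y := mul_div_cancel₀ _ (hhne y hy')
          have e3 : deriv h y * cexp ((-L) y) + h y * (cexp ((-L) y) * -(deriv h y / h y)) = 0 := by
            linear_combination (-cexp ((-L) y)) * hk
          rw [e3] at this
          exact this
        rw [fderivWithin_of_isOpen isOpen_ball hy]
        exact hd1.hasFDerivAt.fderiv.trans (by ext; simp)
    intro z hz
    have := hconst z hz
    rw [hL0, neg_zero, Complex.exp_zero, mul_one] at this
    rw [← this, mul_assoc, ← Complex.exp_add]; simp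
  have hh0 : ‖f 0‖ ≤ ‖h 0‖ := by
    refine le_trans ?_ h2
    have : 1 ≤ (R / R₁) ^ N := one_le_pow₀ hq.le
    nlinarith
  have hRe : ∀ z ∈ ball (0:ℂ) R₁, (L z).re ≤ Real.log M := by
    intro z hz
    have hz' : ‖z‖ ≤ R := by
      have : ‖z‖ < R₁ := by simpa using hz
      linarith
    have h3 := h1 z hz'
    rw [hexp z hz, norm_mul, Complex.norm_exp] at h3
    have h4 : Real.exp (L z).re ≤ M := by
      have h5 : ‖f 0‖ * Real.exp (L z).re ≤ ‖f 0‖ * M := by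
        calc _ ≤ ‖h 0‖ * Real.exp (L z).re := by gcongr
          _ ≤ _ := by linarith
      exact le_of_mul_le_mul_left h5 hf0'
    rw [Real.le_log_iff_exp_le hM0]; exact h4
  have hLd : DifferentiableOn ℂ L (ball 0 R₁) := fun z hz =>
    (hL z hz).differentiableAt.differentiableWithinAt
  have hBC : ∀ z ∈ ball (0:ℂ) (R₁ - δ), ‖L z‖ ≤ 2 * Real.log M * R₁ / δ := by
    intro z hz
    have hzn : ‖z‖ < R₁ - δ := by simpa using hz
    refine (borelCaratheodory_zero (M := Real.log M) (by linarith) hLd hRe hR₁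
      (by simp; linarith) hL0).trans ?_
    gcongr
    · linarith
    · linarith
  have hder : ∀ z ∈ ball (0:ℂ) r, ‖deriv h z / h z‖ ≤ C₂ * Real.log M := by
    intro z hz
    have hzn : ‖z‖ < r := by simpa using hz
    have hzR : z ∈ ball (0:ℂ) R₁ := by simp; linarith
    rw [← (hL z hzR).deriv]
    have hsub : closedBall z (δ/1) ⊆ ball (0:ℂ) R₁ := by
      intro y hy
      have h3 : ‖y - z‖ ≤ δ := by simpa [dist_eq_norm] using hy
      have : ‖y‖ ≤ ‖y - z‖ + ‖z‖ := by simpa using norm_add_le (y - z) z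
      simp; linarith
    have h6 : ∀ δ' , 0 < δ' → δ' < δ → ‖deriv L z‖ ≤ (2 * Real.log M * R₁ / δ) / δ' := by
      intro δ' h0 hlt
      refine Complex.norm_deriv_le_of_forall_mem_sphere_norm_le h0 ?_ ?_
      · apply DifferentiableOn.diffContOnCl
        refine hLd.mono ?_
        rw [closure_ball _ h0.ne']
        exact (closedBall_subset_closedBall (by linarith)).trans hsub
      · intro y hy
        refine hBC y ?_
        have h3 : ‖y - z‖ = δ' := by simpa [dist_eq_norm] using hy
        have : ‖y‖ ≤ ‖y - z‖ + ‖z‖ := by simpa using norm_add_le (y - z) z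
        simp; linarith
    have h7 : ‖deriv L z‖ ≤ (2 * Real.log M * R₁ / δ) / δ := by
      have hc : Filter.Tendsto (fun x : ℝ => (2 * Real.log M * R₁ / δ) / x) (nhdsWithin δ (Set.Iio δ))
          (nhds ((2 * Real.log M * R₁ / δ) / δ)) := by
        refine (ContinuousAt.tendsto ?_).mono_left nhdsWithin_le_nhds
        exact continuousAt_const.div continuousAt_id hδ0.ne'
      refine ge_of_tendsto hc ?_
      filter_upwards [Ioo_mem_nhdsLT hδ0] with x hx using h6 x hx.1 hx.2
    refine h7.trans (le_of_eq ?_)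
    rw [hC₂]; ring
  refine ⟨N, ρ, fun z => deriv h z / h z + ∑ i, (starRingEnd ℂ) (ρ i) / ((R:ℂ) ^ 2 - (starRingEnd ℂ) (ρ i) * z), ?_, ?_, ?_, ?_, ?_⟩
  · refine hN.trans ?_
    gcongr
    have := mul_pos hC₁0 hC₃0
    linarith
  · intro i
    rw [hfac, Finset.prod_eq_zero (Finset.mem_univ i) (sub_self _), zero_mul]
  · refine (hdiv.mono (ball_subset_ball hrR.le)).add ?_
    refine DifferentiableOn.fun_sum fun i _ => ?_
    intro z hz
    have hzn : ‖z‖ < r := by simpa using hz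
    have := hfacne' i z (by linarith)
    refine DifferentiableAt.differentiableWithinAt ?_
    fun_prop (disch := exact this)
  · intro z hz
    have hzn : ‖z‖ < r := by simpa using hz
    have h3 : ‖∑ i, (starRingEnd ℂ) (ρ i) / ((R:ℂ) ^ 2 - (starRingEnd ℂ) (ρ i) * z)‖ ≤ N * C₃ := by
      refine (norm_sum_le _ _).trans ?_
      calc _ ≤ ∑ i : Fin N, C₃ := by
            refine Finset.sum_le_sum fun i _ => ?_
            rw [norm_div, RCLike.norm_conj]
            exact div_le_div₀ hR₁.le (hρ i) hden (hfacne i z (by linarith))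
        _ = _ := by simp
    calc _ ≤ C₂ * Real.log M + N * C₃ := (norm_add_le _ _).trans (add_le_add (hder z hz) h3)
      _ ≤ C₂ * Real.log M + (C₁ * Real.log M) * C₃ := by gcongr
      _ ≤ _ := by nlinarith
  · intro z hz hfz
    have hzn : ‖z‖ < r := by simpa using hz
    have hzn' : ‖z‖ ≤ R₁ := by linarith
    have hne : ∀ i, z - ρ i ≠ 0 := by
      intro i h0
      apply hfz
      rw [hfac, Finset.prod_eq_zero (Finset.mem_univ i) h0, zero_mul]
    have e1 : logDeriv f z = ∑ i, 1 / (z - ρ i) + logDeriv g z := by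
      have : f = fun z => (∏ i, (z - ρ i)) * g z := funext hfac
      rw [this, logDeriv_mul z (Finset.prod_ne_zero_iff.mpr fun i _ => hne i) (hgne z hzn') (by fun_prop) (hg z)]
      congr 1
      rw [logDeriv_prod (fun i _ => hne i) (fun i _ => by fun_prop)]
      refine Finset.sum_congr rfl fun i _ => ?_
      simp [logDeriv_apply]
    have e2 : logDeriv h z = logDeriv g z + ∑ i, -((starRingEnd ℂ) (ρ i) / ((R:ℂ) ^ 2 - (starRingEnd ℂ) (ρ i) * z)) := by
      rw [hh, logDeriv_mul z (hgne z hzn') (Finset.prod_ne_zero_iff.mpr fun i _ => div_ne_zero (hfacne' i z hzn') hRc) (hg z) (by fun_prop)]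
      congr 1
      rw [logDeriv_prod (f := fun i z => ((R:ℂ) ^ 2 - (starRingEnd ℂ) (ρ i) * z) / R) (x := z)
        (fun i _ => div_ne_zero (hfacne' i z hzn') hRc) (fun i _ => by fun_prop)]
      refine Finset.sum_congr rfl fun i _ => ?_
      have hd : HasDerivAt (fun z => ((R:ℂ) ^ 2 - (starRingEnd ℂ) (ρ i) * z) / R) (-(starRingEnd ℂ) (ρ i) / R) z := by
        have := (((hasDerivAt_id z).const_mul ((starRingEnd ℂ) (ρ i))).const_sub ((R:ℂ)^2)).div_const (R:ℂ)
        simpa using this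
      rw [logDeriv_apply, hd.deriv]
      have := hfacne' i z hzn'
      field_simp
    rw [logDeriv_apply] at e1 e2
    simp only []
    rw [e1, e2, Finset.sum_neg_distrib]
    ring

end LDA

namespace LDA
open Complex Metric MeasureTheory Set Filter Asymptotics

lemma norm_sum_char_le {q : ℕ} [NeZero q] (χ : DirichletCharacter ℂ q) (hχ : χ ≠ 1) (n : ℕ) :
    ‖∑ k ∈ Finset.range n, χ k‖ ≤ q := by
  have hfull : ∑ k ∈ Finset.range q, χ (k : ZMod q) = 0 := by
    rw [← MulChar.sum_eq_zero_of_ne_one hχ]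
    refine Finset.sum_bij (fun k _ => (k : ZMod q)) (by simp) ?_ ?_ (by simp)
    · intro a ha b hb hab
      have := (ZMod.natCast_eq_natCast_iff' a b q).mp hab
      rwa [Nat.mod_eq_of_lt (Finset.mem_range.mp ha), Nat.mod_eq_of_lt (Finset.mem_range.mp hb)] at this
    · intro b _
      exact ⟨b.val, Finset.mem_range.mpr (ZMod.val_lt b), by simp⟩
  have hmul : ∀ a b : ℕ, ∑ k ∈ Finset.range (q * a + b), χ (k : ZMod q) = ∑ k ∈ Finset.range b, χ (k : ZMod q) := by
    intro a b
    induction a with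
    | zero => simp
    | succ a ih =>
      rw [show q * (a + 1) + b = q + (q * a + b) by ring, Finset.sum_range_add, hfull, zero_add, ← ih]
      simp
  rw [← Nat.div_add_mod n q, hmul]
  refine (norm_sum_le _ _).trans ?_
  calc _ ≤ ∑ k ∈ Finset.range (n % q), (1:ℝ) := Finset.sum_le_sum fun k _ => χ.norm_le_one _
    _ = ((n % q : ℕ) : ℝ) := by simp
    _ ≤ q := by exact_mod_cast (Nat.mod_lt n (NeZero.pos q)).le

lemma norm_sum_char_le' {q : ℕ} [NeZero q] (hq : 3 ≤ q) (χ : DirichletCharacter ℂ q) (hχ : χ ≠ 1) (n : ℕ) :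
    ‖∑ k ∈ Finset.Icc 1 n, χ k‖ ≤ q := by
  have h0 : χ ((0:ℕ) : ZMod q) = 0 := by
    have : Fact (1 < q) := ⟨by omega⟩
    rw [Nat.cast_zero]
    exact χ.map_nonunit not_isUnit_zero
  have : ∑ k ∈ Finset.Icc 1 n, χ (k : ZMod q) = ∑ k ∈ Finset.range (n+1), χ (k : ZMod q) := by
    rw [Finset.range_eq_Ico, Finset.sum_eq_sum_Ico_succ_bot (by omega), h0, zero_add]
    rfl
  rw [this]
  exact norm_sum_char_le χ hχ _

lemma norm_LFunction_le {q : ℕ} [NeZero q] (hq : 3 ≤ q) (χ : DirichletCharacter ℂ q) (hχ : χ ≠ 1) {s : ℂ}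
    (hs : 0 < s.re) : ‖DirichletCharacter.LFunction χ s‖ ≤ q * ‖s‖ / s.re := by
  set S : ℝ → ℂ := fun t => ∑ k ∈ Finset.Icc 1 ⌊t⌋₊, χ k with hS
  have hSb : ∀ t, ‖S t‖ ≤ q := fun t => norm_sum_char_le' hq χ hχ _
  have hSm : Measurable S := by
    have : S = (fun n : ℕ => ∑ k ∈ Finset.Icc 1 n, χ k) ∘ (fun t : ℝ => ⌊t⌋₊) := rfl
    rw [this]
    exact (measurable_from_nat).comp Nat.measurable_floor
  set g : ℝ → ℂ := (Ioi (1:ℝ)).indicator S with hg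
  have hgm : Measurable g := hSm.indicator measurableSet_Ioi
  have hgb : ∀ t, ‖g t‖ ≤ q := by
    intro t
    rw [hg]
    refine (norm_indicator_le_norm_self _ _).trans (hSb t)
  have hgl : LocallyIntegrableOn g (Ioi 0) := by
    apply LocallyIntegrable.locallyIntegrableOn
    refine (locallyIntegrable_const (q:ℝ)).mono hgm.aestronglyMeasurable ?_
    filter_upwards with t
    simpa using hgb t
  have hdiff : ∀ s : ℂ, 0 < s.re → DifferentiableAt ℂ (fun s => s * mellin g (-s)) s := by
    intro s hs
    refine differentiableAt_id.mul ?_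
    have : DifferentiableAt ℂ (mellin g) (-s) := by
      refine mellin_differentiableAt_of_isBigO_rpow (a := 0) (b := (-s).re - 1) hgl ?_ (by simpa using hs) ?_ (by linarith)
      · simp only [neg_zero, Real.rpow_zero]
        exact IsBigO.of_bound q (Eventually.of_forall fun t => by simpa using hgb t)
      · refine IsBigO.of_bound 0 ?_
        have : Ioo (0:ℝ) 1 ∈ nhdsWithin (0:ℝ) (Ioi 0) := Ioo_mem_nhdsGT one_pos
        filter_upwards [this] with t ht
        have : g t = 0 := by
          rw [hg, indicator_of_notMem]; simpa using ht.2.le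
        simp [this]
    exact this.comp s differentiableAt_id.neg
  have hIntg : ∀ s : ℂ, mellin g (-s) = ∫ t in Ioi (1:ℝ), S t * (t:ℂ) ^ (-(s+1)) := by
    intro s
    rw [mellin, ← integral_indicator measurableSet_Ioi, ← integral_indicator measurableSet_Ioi]
    congr 1
    ext t
    by_cases ht : 1 < t
    · rw [indicator_of_mem (show t ∈ Ioi (0:ℝ) from by simp; linarith), indicator_of_mem (show t ∈ Ioi (1:ℝ) from ht), hg, indicator_of_mem (show t ∈ Ioi (1:ℝ) from ht), smul_eq_mul, mul_comm]
      congr 2; ring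
    · rw [indicator_of_notMem (s := Ioi (1:ℝ)) (by simpa using ht)]
      by_cases h0 : 0 < t
      · rw [indicator_of_mem (show t ∈ Ioi (0:ℝ) from h0), hg, indicator_of_notMem (s := Ioi (1:ℝ)) (by simpa using ht)]
        simp
      · rw [indicator_of_notMem (by simpa using h0)]
  have hbig : ∀ s : ℂ, 1 < s.re → DirichletCharacter.LFunction χ s = s * mellin g (-s) := by
    intro s hs
    rw [DirichletCharacter.LFunction_eq_LSeries χ hs, hIntg]
    refine LSeries_eq_mul_integral _ (r := 0) le_rfl (by linarith) (χ.LSeriesSummable_of_one_lt_re hs) ?_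
    simp only [Real.rpow_zero]
    exact IsBigO.of_bound q (Eventually.of_forall fun n => by simpa using norm_sum_char_le' hq χ hχ n)
  have hU : IsOpen {s : ℂ | 0 < s.re} := isOpen_lt continuous_const continuous_re
  have hall : EqOn (DirichletCharacter.LFunction χ) (fun s => s * mellin g (-s)) {s : ℂ | 0 < s.re} := by
    refine AnalyticOnNhd.eqOn_of_preconnected_of_eventuallyEq (𝕜 := ℂ) ?_ ?_ ?_ (z₀ := 2) (by simp) ?_
    · exact ((DirichletCharacter.differentiable_LFunction hχ).differentiableOn).analyticOnNhd hU
    · exact DifferentiableOn.analyticOnNhd (fun s hs => (hdiff s hs).differentiableWithinAt) hU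
    · exact (convex_halfSpace_re_gt 0).isPreconnected
    · have : {s : ℂ | 1 < s.re} ∈ nhds (2:ℂ) := (isOpen_lt continuous_const continuous_re).mem_nhds (by simp)
      filter_upwards [this] with s hs using hbig s hs
  rw [hall hs]
  simp only [norm_mul, hIntg]
  have hI : ‖∫ t in Ioi (1:ℝ), S t * (t:ℂ) ^ (-(s+1))‖ ≤ ∫ t in Ioi (1:ℝ), q * t ^ (-s.re - 1) := by
    refine norm_integral_le_of_norm_le ((integrableOn_Ioi_rpow_of_lt (by linarith) one_pos).const_mul _) ?_
    filter_upwards [ae_restrict_mem measurableSet_Ioi] with t ht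
    have ht0 : 0 < t := lt_trans one_pos ht
    rw [norm_mul, norm_cpow_eq_rpow_re_of_pos ht0]
    simp only [neg_re, add_re, one_re]
    rw [show -(s.re+1) = -s.re - 1 by ring]
    gcongr
    exact hSb t
  rw [integral_const_mul, integral_Ioi_rpow_of_lt (by linarith) one_pos] at hI
  calc _ ≤ ‖s‖ * (q * (-1 ^ (-s.re - 1 + 1) / (-s.re - 1 + 1))) := by gcongr
    _ = _ := by
      rw [Real.one_rpow]
      have : -s.re - 1 + 1 = -s.re := by ring
      rw [this]; field_simp

lemma norm_LFunction_two_ge {q : ℕ} [NeZero q] (χ : DirichletCharacter ℂ q) {s : ℂ}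
    (hs : s.re = 2) : 1 / 4 ≤ ‖DirichletCharacter.LFunction χ s‖ := by
  have hs1 : 1 < s.re := by linarith
  rw [DirichletCharacter.LFunction_eq_LSeries χ hs1]
  have hsum := χ.LSeriesSummable_of_one_lt_re hs1
  rw [LSeries, hsum.tsum_eq_add_tsum_ite 1]
  have h1 : LSeries.term (fun n => χ n) s 1 = 1 := by simp [LSeries.term]
  rw [h1]
  have hz : HasSum (fun n : ℕ => 1 / (n:ℝ) ^ 2) (Real.pi ^ 2 / 6) := hasSum_zeta_two
  have hz2 : Summable (fun n : ℕ => if n = 1 then 0 else 1 / (n:ℝ) ^ 2) := by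
    refine Summable.of_nonneg_of_le (fun n => by split_ifs <;> positivity) (fun n => ?_) hz.summable
    split_ifs
    · positivity
    · exact le_rfl
  have hz3 : ∑' n : ℕ, (if n = 1 then 0 else 1 / (n:ℝ) ^ 2) ≤ 3/4 := by
    have := hz.summable.tsum_eq_add_tsum_ite 1
    rw [hz.tsum_eq] at this
    have hpi := Real.pi_lt_d2
    have hpi0 := Real.pi_pos
    norm_num at this ⊢
    nlinarith
  have hle : ‖∑' n : ℕ, (if n = 1 then 0 else LSeries.term (fun n => χ n) s n)‖ ≤ 3/4 := by
    refine (tsum_of_norm_bounded hz2.hasSum fun n => ?_).trans hz3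
    split_ifs with h
    · simp
    · rw [LSeries.norm_term_eq]
      split_ifs with h0
      · positivity
      · rw [hs, Real.rpow_two]
        gcongr
        exact χ.norm_le_one _
  have := norm_sub_norm_le (1:ℂ) (-(∑' n : ℕ, (if n = 1 then 0 else LSeries.term (fun n => χ n) s n)))
  rw [sub_neg_eq_add, norm_neg, norm_one] at this
  linarith

end LDA

namespace LDA
open Complex Metric MeasureTheory Set Filter Asymptotics

/-- the logarithmic derivative of `L(s, χ)` -/
noncomputable def LD {q : ℕ} [NeZero q] (χ : DirichletCharacter ℂ q) (s : ℂ) : ℂ :=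
  deriv (DirichletCharacter.LFunction χ) s / DirichletCharacter.LFunction χ s

lemma local_L : ∃ C : ℝ, 0 < C ∧ ∀ (q : ℕ) [NeZero q], 3 ≤ q → ∀ χ : DirichletCharacter ℂ q, χ ≠ 1 →
    ∀ t₀ : ℝ, ∃ (N : ℕ) (ρ : Fin N → ℂ) (φ : ℂ → ℂ), (N : ℝ) ≤ C * Real.log (q * (|t₀| + 2)) ∧
      (∀ i, DirichletCharacter.LFunction χ (ρ i) = 0) ∧
      DifferentiableOn ℂ φ (ball (2 + t₀ * I) (33/20)) ∧
      (∀ z ∈ ball (2 + t₀ * I : ℂ) (33/20), ‖φ z‖ ≤ C * Real.log (q * (|t₀| + 2))) ∧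
      ∀ z ∈ ball (2 + t₀ * I : ℂ) (33/20), DirichletCharacter.LFunction χ z ≠ 0 →
        LD χ z = φ z + ∑ i, 1 / (z - ρ i) := by
  obtain ⟨C, hC, H⟩ := local_fact (r := 33/20) (R₁ := 17/10) (R := 9/5) (by norm_num) (by norm_num) (by norm_num)
  refine ⟨C * 4, by positivity, ?_⟩
  intro q _ hq χ hχ t₀
  set s0 : ℂ := 2 + t₀ * I with hs0
  have hre : s0.re = 2 := by simp [hs0]
  have hq' : (3:ℝ) ≤ q := by exact_mod_cast hq
  have ht := abs_nonneg t₀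
  set M : ℝ := 20 * q * (|t₀| + 4) with hM
  have hQ : (6:ℝ) ≤ q * (|t₀| + 2) := by nlinarith
  have hMpos : 0 < M := by positivity
  have hM3 : Real.exp 1 ≤ M := by
    have := Real.exp_one_lt_d9
    have : 240 ≤ M := by rw [hM]; nlinarith
    linarith
  have hlog1 : 1 ≤ Real.log M := by
    rw [Real.le_log_iff_exp_le hMpos]; exact hM3
  have hlog2 : Real.log M ≤ 4 * Real.log (q * (|t₀| + 2)) := by
    rw [show (4:ℝ) * Real.log (q * (|t₀| + 2)) = Real.log ((q * (|t₀| + 2))^4) by rw [Real.log_pow]; norm_num]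
    apply Real.log_le_log hMpos
    have h1 : M ≤ 40 * (q * (|t₀| + 2)) := by rw [hM]; nlinarith
    have h2 : (40:ℝ) ≤ (q * (|t₀| + 2))^3 := by
      calc (40:ℝ) ≤ 6^3 := by norm_num
        _ ≤ _ := by gcongr
    calc M ≤ 40 * (q * (|t₀| + 2)) := h1
      _ ≤ (q * (|t₀| + 2))^3 * (q * (|t₀| + 2)) := by gcongr
      _ = _ := by ring
  have hdL := DirichletCharacter.differentiable_LFunction hχ
  have h4 := norm_LFunction_two_ge χ hre
  obtain ⟨N, ρ, φ, h1, h2, h3, h5, h6⟩ := H (fun z => DirichletCharacter.LFunction χ (s0 + z)) M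
    (hdL.comp (differentiable_id.const_add s0)) hlog1 hMpos
    (by simp only [add_zero]; intro h; rw [h, norm_zero] at h4; norm_num at h4)
    (by
      intro z hz
      simp only [add_zero]
      have hzre : (1/5:ℝ) ≤ (s0 + z).re := by
        have := (abs_le.mp (abs_re_le_norm z)).1
        rw [add_re, hre]; linarith
      have hn : ‖s0 + z‖ ≤ |t₀| + 4 := by
        calc ‖s0 + z‖ ≤ ‖s0‖ + ‖z‖ := norm_add_le _ _
          _ ≤ (‖(2:ℂ)‖ + ‖(t₀:ℂ) * I‖) + 9/5 := by gcongr; exact norm_add_le _ _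
          _ ≤ _ := by simp; linarith
      calc _ ≤ q * ‖s0 + z‖ / (s0 + z).re := norm_LFunction_le hq χ hχ (by linarith)
        _ ≤ q * (|t₀| + 4) / (1/5) := by gcongr
        _ = M * (1/4) := by rw [hM]; ring
        _ ≤ _ := by gcongr)
  have hball : ∀ z ∈ ball s0 (33/20), z - s0 ∈ ball (0:ℂ) (33/20) := by
    intro z hz; rw [mem_ball, dist_eq] at hz; simpa using hz
  refine ⟨N, fun i => s0 + ρ i, fun z => φ (z - s0), ?_, ?_, ?_, ?_, ?_⟩
  · calc (N:ℝ) ≤ C * Real.log M := h1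
      _ ≤ C * (4 * _) := by gcongr
      _ = _ := by ring
  · exact h2
  · exact h3.comp (differentiable_id.sub_const s0).differentiableOn hball
  · intro z hz
    calc _ ≤ C * Real.log M := h5 _ (hball z hz)
      _ ≤ C * (4 * _) := by gcongr
      _ = _ := by ring
  · intro z hz hne
    have := h6 (z - s0) (hball z hz) (by simpa using hne)
    rw [deriv_comp_const_add (f := DirichletCharacter.LFunction χ)] at this
    simp only [add_sub_cancel] at this
    rw [LD, this]
    congr 1
    apply Finset.sum_congr rfl
    intro i _
    rw [sub_sub]

lemma zero_dist {q : ℕ} [NeZero q] {χ : DirichletCharacter ℂ q} (hχ : χ ≠ 1) {σ₀ Y : ℝ}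
    (hz : ∀ z : ℂ, σ₀ < z.re → z.re ≤ 1 → |z.im| ≤ Y + 2 → DirichletCharacter.LFunction χ z ≠ 0)
    {ρ : ℂ} (hρ : DirichletCharacter.LFunction χ ρ = 0) : ρ.re ≤ σ₀ ∨ Y + 2 < |ρ.im| := by
  by_contra! h
  rcases le_or_gt ρ.re 1 with h1 | h1
  · exact hz ρ h.1 h1 h.2 hρ
  · exact DirichletCharacter.LFunction_ne_zero_of_one_le_re χ (Or.inl hχ) h1.le hρ

lemma L_ne {q : ℕ} [NeZero q] {χ : DirichletCharacter ℂ q} (hχ : χ ≠ 1) {σ₀ Y : ℝ}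
    (hz : ∀ z : ℂ, σ₀ < z.re → z.re ≤ 1 → |z.im| ≤ Y + 2 → DirichletCharacter.LFunction χ z ≠ 0)
    {s : ℂ} (hs : σ₀ < s.re) (hs' : |s.im| ≤ Y + 2) : DirichletCharacter.LFunction χ s ≠ 0 := by
  intro h
  rcases zero_dist hχ hz h with h | h <;> linarith

lemma zero_dist2 {q : ℕ} [NeZero q] {χ : DirichletCharacter ℂ q} (hχ : χ ≠ 1) {σ₀ Y u : ℝ}
    (hz : ∀ z : ℂ, σ₀ < z.re → z.re ≤ 1 → |z.im| ≤ Y + 2 → DirichletCharacter.LFunction χ z ≠ 0)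
    (hu : 0 < u) (hu1 : u ≤ 1)
    {ρ : ℂ} (hρ : DirichletCharacter.LFunction χ ρ = 0) {s : ℂ} (hs : σ₀ + u ≤ s.re) (hs' : |s.im| ≤ Y) :
    (u ^ 2 + (s.im - ρ.im) ^ 2) / 2 ≤ ‖s - ρ‖ ^ 2 ∧ u ≤ ‖s - ρ‖ := by
  have h1 := abs_re_le_norm (s - ρ)
  have h2 := abs_im_le_norm (s - ρ)
  have h3 : ‖s - ρ‖ ^ 2 = (s.re - ρ.re) ^ 2 + (s.im - ρ.im) ^ 2 := by
    rw [← normSq_eq_norm_sq, normSq_apply]; simp; ring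
  rw [sub_re] at h1
  rw [sub_im] at h2
  rcases zero_dist hχ hz hρ with h | h
  · have : u ≤ s.re - ρ.re := by linarith
    constructor
    · rw [h3]; nlinarith [sq_nonneg (s.im - ρ.im)]
    · linarith [le_abs_self (s.re - ρ.re)]
  · have h4 : 2 ≤ |s.im - ρ.im| := by
      have := abs_sub_abs_le_abs_sub ρ.im s.im
      rw [abs_sub_comm] at this
      linarith
    constructor
    · have : u ^ 2 ≤ (s.im - ρ.im) ^ 2 := by rw [← sq_abs (s.im - ρ.im)]; gcongr; linarith
      rw [h3]; nlinarith [sq_nonneg (s.re - ρ.re)]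
    · linarith

lemma ptwise : ∃ C : ℝ, 0 < C ∧ ∀ (q : ℕ) [NeZero q], 3 ≤ q → ∀ χ : DirichletCharacter ℂ q, χ ≠ 1 →
    ∀ σ₀ Y u : ℝ, 1/2 ≤ σ₀ →
    (∀ z : ℂ, σ₀ < z.re → z.re ≤ 1 → |z.im| ≤ Y + 2 → DirichletCharacter.LFunction χ z ≠ 0) →
    0 < u → u ≤ 1 → ∀ s : ℂ, σ₀ + u ≤ s.re → s.re ≤ 2 → |s.im| ≤ Y →
    ‖LD χ s‖ ≤ C * Real.log (q * (|s.im| + 2)) / u := by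
  obtain ⟨C, hC, H⟩ := local_L
  refine ⟨2 * C, by positivity, ?_⟩
  intro q _ hq χ hχ σ₀ Y u hσ₀ hz hu hu1 s hs hs2 hsY
  obtain ⟨N, ρ, φ, h1, h2, h3, h4, h5⟩ := H q hq χ hχ s.im
  set Lg := Real.log (q * (|s.im| + 2)) with hLg
  have hsb : s ∈ ball (2 + s.im * I : ℂ) (33/20) := by
    rw [mem_ball, dist_eq]
    have : s - (2 + s.im * I) = ((s.re - 2 : ℝ) : ℂ) := by
      apply Complex.ext <;> simp
    rw [this, norm_real, Real.norm_eq_abs, abs_lt]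
    constructor <;> linarith
  have hLg0 : 0 ≤ C * Lg := le_trans (norm_nonneg _) (h4 s hsb)
  rw [h5 s hsb (L_ne hχ hz (by linarith) (by linarith))]
  calc _ ≤ ‖φ s‖ + ‖∑ i, 1 / (s - ρ i)‖ := norm_add_le _ _
    _ ≤ C * Lg + ∑ i : Fin N, 1 / u := by
        gcongr
        · exact h4 s hsb
        · refine (norm_sum_le _ _).trans (Finset.sum_le_sum fun i _ => ?_)
          rw [norm_div, norm_one]
          exact one_div_le_one_div_of_le hu (zero_dist2 hχ hz hu hu1 (h2 i) hs hsY).2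
    _ = C * Lg + N / u := by simp [div_eq_mul_inv]
    _ ≤ C * Lg / u + C * Lg / u := by
        gcongr
        rw [le_div_iff₀ hu]; nlinarith
    _ = _ := by ring

lemma LD_diff {q : ℕ} [NeZero q] {χ : DirichletCharacter ℂ q} (hχ : χ ≠ 1) :
    DifferentiableOn ℂ (LD χ) {s | DirichletCharacter.LFunction χ s ≠ 0} := by
  have hdL := DirichletCharacter.differentiable_LFunction hχ
  have : Differentiable ℂ (deriv (DirichletCharacter.LFunction χ)) := hdL.deriv
  intro s hs
  exact ((this s).div (hdL s) hs).differentiableWithinAt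

lemma L_open {q : ℕ} [NeZero q] {χ : DirichletCharacter ℂ q} (hχ : χ ≠ 1) :
    IsOpen {s | DirichletCharacter.LFunction χ s ≠ 0} :=
  isOpen_ne_fun (DirichletCharacter.differentiable_LFunction hχ).continuous continuous_const

lemma int_arctan (u γ a : ℝ) (hu : 0 < u) :
    ∫ t in a..a+1, 2 / (u ^ 2 + (t - γ) ^ 2) ≤ 2 * Real.pi / u := by
  have hd : ∀ t ∈ uIcc a (a+1), HasDerivAt (fun t => 2 / u * Real.arctan ((t - γ) / u)) (2 / (u ^ 2 + (t - γ) ^ 2)) t := by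
    intro t _
    have h := ((((hasDerivAt_id t).sub_const γ).div_const u).arctan).const_mul (2 / u)
    refine h.congr_deriv ?_
    simp only [id]
    field_simp
  rw [intervalIntegral.integral_eq_sub_of_hasDerivAt hd]
  · have h1 := Real.arctan_lt_pi_div_two ((a + 1 - γ) / u)
    have h2 := Real.neg_pi_div_two_lt_arctan ((a - γ) / u)
    rw [← mul_sub, show 2 * Real.pi / u = 2 / u * Real.pi by ring]
    gcongr
    linarith
  · apply ContinuousOn.intervalIntegrable
    apply ContinuousOn.div (by fun_prop) (by fun_prop)
    intro t _
    positivity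

lemma block : ∃ C : ℝ, 0 < C ∧ ∀ (q : ℕ) [NeZero q], 3 ≤ q → ∀ χ : DirichletCharacter ℂ q, χ ≠ 1 →
    ∀ σ₀ Y u : ℝ, 1/2 ≤ σ₀ →
    (∀ z : ℂ, σ₀ < z.re → z.re ≤ 1 → |z.im| ≤ Y + 2 → DirichletCharacter.LFunction χ z ≠ 0) →
    0 < u → u ≤ 1 → ∀ σ₁ : ℝ, σ₀ + u ≤ σ₁ → σ₁ ≤ 2 → ∀ a : ℝ, (∀ t ∈ Icc a (a+1), |t| ≤ Y) →
    ∫ t in a..a+1, ‖deriv (LD χ) (σ₁ + t * I)‖ ≤ C * Real.log (q * (|a| + 2)) / u := by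
  obtain ⟨C, hC, H⟩ := local_L
  refine ⟨(100 + 2 * Real.pi) * C * 2, by positivity, ?_⟩
  intro q _ hq χ hχ σ₀ Y u hσ₀ hz hu hu1 σ₁ hs hs2 a haY
  obtain ⟨N, ρ, φ, h1, h2, h3, h4, h5⟩ := H q hq χ hχ (a + 1/2)
  set Lg := Real.log (q * (|a + 1/2| + 2)) with hLg
  set s0 : ℂ := 2 + (a + 1/2 : ℝ) * I with hs0
  have hq' : (3:ℝ) ≤ q := by exact_mod_cast hq
  have ht := abs_nonneg a
  have hLg2 : Lg ≤ 2 * Real.log (q * (|a| + 2)) := by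
    rw [show (2:ℝ) * Real.log (q * (|a| + 2)) = Real.log ((q * (|a| + 2))^2) by rw [Real.log_pow]; norm_num]
    apply Real.log_le_log (by positivity)
    have : |a + 1/2| ≤ |a| + 1/2 := (abs_add_le _ _).trans (by norm_num)
    have h6 : 6 ≤ q * (|a| + 2) := by nlinarith
    nlinarith
  have hsb : ∀ t ∈ Icc a (a+1), dist (σ₁ + t * I : ℂ) s0 < 8/5 := by
    intro t ht
    have : dist (σ₁ + t * I : ℂ) s0 ^ 2 < (8/5)^2 := by
      rw [dist_eq, ← normSq_eq_norm_sq, normSq_apply]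
      simp [hs0]
      have := ht.1
      have := ht.2
      nlinarith
    exact lt_of_pow_lt_pow_left₀ 2 (by norm_num) this
  have hLg0 : 0 ≤ C * Lg := le_trans (norm_nonneg _) (h4 s0 (by simp))
  have hLne : ∀ t ∈ Icc a (a+1), DirichletCharacter.LFunction χ (σ₁ + t * I) ≠ 0 := by
    intro t ht
    apply L_ne hχ hz (by simp; linarith)
    simp
    linarith [haY t ht]
  have hpt : ∀ t ∈ Icc a (a+1), ‖deriv (LD χ) (σ₁ + t * I)‖ ≤ 100 * (C * Lg) + ∑ i, 2 / (u ^ 2 + (t - (ρ i).im) ^ 2) := by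
    intro t ht
    set s : ℂ := σ₁ + t * I with hs'
    have hsre : s.re = σ₁ := by simp [hs']
    have hsim : s.im = t := by simp [hs']
    have hsball : ball s (1/20) ⊆ ball s0 (33/20) := by
      apply ball_subset_ball'
      linarith [hsb t ht]
    have hsball2 : closedBall s (1/25) ⊆ ball s0 (33/20) :=
      (closedBall_subset_ball (by norm_num)).trans hsball
    have hsmem : s ∈ ball s0 (33/20) := hsball (mem_ball_self (by norm_num))
    have hev : LD χ =ᶠ[nhds s] fun z => φ z + ∑ i, 1 / (z - ρ i) := by
      filter_upwards [isOpen_ball.mem_nhds hsmem, (L_open hχ).mem_nhds (hLne t ht)] with z hz1 hz2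
      exact h5 z hz1 hz2
    have hφd : DifferentiableAt ℂ φ s := (h3 s hsmem).differentiableAt (isOpen_ball.mem_nhds hsmem)
    have hsne : ∀ i, s - ρ i ≠ 0 := by
      intro i h
      have := (zero_dist2 hχ hz hu hu1 (h2 i) (s := s) (by rw [hsre]; exact hs) (by rw [hsim]; exact haY t ht)).2
      rw [h, norm_zero] at this
      linarith
    have hder : HasDerivAt (fun z => φ z + ∑ i, 1 / (z - ρ i)) (deriv φ s + ∑ i, (-(1 / (s - ρ i)^2))) s := by
      refine hφd.hasDerivAt.add (HasDerivAt.fun_sum fun i _ => ?_)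
      have := ((hasDerivAt_id s).sub_const (ρ i)).fun_inv (hsne i)
      simp only [one_div]
      refine this.congr_deriv ?_
      simp only [id]
      ring
    rw [hev.deriv_eq, hder.deriv]
    have hφ' : ‖deriv φ s‖ ≤ (C * Lg) / (1/25) := by
      apply norm_deriv_le_of_forall_mem_sphere_norm_le (by norm_num)
      · exact (h3.mono (by rw [closure_ball s (by norm_num)]; exact hsball2)).diffContOnCl
      · intro z hz
        exact h4 z (hsball2 (sphere_subset_closedBall hz))
    calc _ ≤ ‖deriv φ s‖ + ‖∑ i, (-(1 / (s - ρ i)^2))‖ := norm_add_le _ _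
      _ ≤ _ := by
        gcongr
        · calc _ ≤ _ := hφ'
            _ ≤ _ := by rw [div_le_iff₀ (by norm_num)]; linarith
        · refine (norm_sum_le _ _).trans (Finset.sum_le_sum fun i _ => ?_)
          have := (zero_dist2 hχ hz hu hu1 (h2 i) (s := s) (by rw [hsre]; exact hs) (by rw [hsim]; exact haY t ht)).1
          rw [hsim] at this
          rw [norm_neg, norm_div, norm_one, norm_pow]
          calc 1 / ‖s - ρ i‖^2 ≤ 1 / ((u ^ 2 + (t - (ρ i).im) ^ 2) / 2) := by gcongr
            _ = _ := by rw [one_div_div]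
  have hcont : ContinuousOn (fun t : ℝ => ‖deriv (LD χ) (σ₁ + t * I)‖) (uIcc a (a+1)) := by
    rw [uIcc_of_le (by linarith)]
    have : ContinuousOn (deriv (LD χ)) {s | DirichletCharacter.LFunction χ s ≠ 0} :=
      ((LD_diff hχ).deriv (L_open hχ)).continuousOn
    exact (this.comp (f := fun t : ℝ => (σ₁ + t * I : ℂ)) (by fun_prop) (fun t ht => hLne t ht)).norm
  have hi : ∀ i : Fin N, IntervalIntegrable (fun t => 2 / (u ^ 2 + (t - (ρ i).im) ^ 2)) volume a (a+1) := by
    intro i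
    apply ContinuousOn.intervalIntegrable
    apply ContinuousOn.div (by fun_prop) (by fun_prop)
    intro t _
    positivity
  have hisum : IntervalIntegrable (fun t => ∑ i, 2 / (u ^ 2 + (t - (ρ i).im) ^ 2)) volume a (a+1) := by
    apply ContinuousOn.intervalIntegrable
    refine continuousOn_finsetSum _ fun i _ => ?_
    apply ContinuousOn.div (by fun_prop) (by fun_prop)
    intro t _
    positivity
  calc _ ≤ ∫ t in a..a+1, (100 * (C * Lg) + ∑ i, 2 / (u ^ 2 + (t - (ρ i).im) ^ 2)) := by
        apply intervalIntegral.integral_mono_on (by linarith) hcont.intervalIntegrable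
        · exact intervalIntegrable_const.add hisum
        · exact hpt
    _ = 100 * (C * Lg) + ∑ i, ∫ t in a..a+1, 2 / (u ^ 2 + (t - (ρ i).im) ^ 2) := by
        rw [intervalIntegral.integral_add intervalIntegrable_const hisum,
          intervalIntegral.integral_finsetSum (fun i _ => hi i)]
        simp
    _ ≤ 100 * (C * Lg) + ∑ i : Fin N, 2 * Real.pi / u := by
        gcongr with i
        exact int_arctan u _ a hu
    _ = 100 * (C * Lg) + N * (2 * Real.pi / u) := by simp
    _ ≤ 100 * (C * Lg / u) + (C * Lg) * (2 * Real.pi / u) := by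
        gcongr
        rw [le_div_iff₀ hu]; nlinarith
    _ = (100 + 2 * Real.pi) * C * Lg / u := by ring
    _ ≤ (100 + 2 * Real.pi) * C * (2 * Real.log (q * (|a| + 2))) / u := by gcongr
    _ = _ := by ring

end LDA

namespace LDA
open Complex Metric MeasureTheory Set Filter Asymptotics

/-- the kernel 1/(w(w+1)) -/
noncomputable def ker (w : ℂ) : ℂ := 1 / (w * (w + 1))

lemma ker_ne {c : ℝ} (hc : 0 < c) (y : ℝ) : (c + y * I : ℂ) ≠ 0 ∧ (c + y * I + 1 : ℂ) ≠ 0 := by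
  constructor
  · intro h
    have := congrArg re h
    simp at this; linarith
  · intro h
    have := congrArg re h
    simp at this; linarith

lemma norm_ker_le {c : ℝ} (hc : 0 < c) (y : ℝ) : ‖ker (c + y * I)‖ ≤ (1 / min (c * (c+1)) 1) * (1 + y^2)⁻¹ := by
  have hm : 0 < min (c * (c+1)) 1 := lt_min (by positivity) one_pos
  have h1 : ‖(c + y * I : ℂ)‖ ^ 2 = c^2 + y^2 := by
    rw [← normSq_eq_norm_sq, normSq_apply]; simp; ring
  have h2 : ‖(c + y * I + 1 : ℂ)‖ ^ 2 = (c+1)^2 + y^2 := by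
    rw [← normSq_eq_norm_sq, normSq_apply]; simp; ring
  have h3 : min (c * (c+1)) 1 * (1 + y^2) ≤ ‖(c + y * I : ℂ)‖ * ‖(c + y * I + 1 : ℂ)‖ := by
    refine (pow_le_pow_iff_left₀ (by positivity) (by positivity) two_ne_zero).mp ?_
    rw [mul_pow, mul_pow, h1, h2]
    have ha : min (c * (c+1)) 1 ^2 ≤ (c*(c+1))^2 := by gcongr; exact min_le_left _ _
    have hb : min (c * (c+1)) 1 ^2 ≤ 1 := by apply pow_le_one₀ hm.le (min_le_right _ _)
    have hd : min (c * (c+1)) 1 ≤ c * (c+1) := min_le_left _ _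
    have hd' : min (c * (c+1)) 1 ^ 2 ≤ c * (c+1) := by
      nlinarith [min_le_right (c * (c+1)) 1]
    nlinarith [sq_nonneg y, mul_nonneg (sub_nonneg.2 hd') (sq_nonneg y), mul_nonneg (sub_nonneg.2 hb) (sq_nonneg (y^2)), mul_nonneg (sq_nonneg y) (sq_nonneg c), hc, mul_nonneg (sq_nonneg y) hc.le]
  rw [ker, norm_div, norm_one, norm_mul, ← one_div_mul_one_div_rev, mul_comm, ← one_div, one_div_mul_one_div, one_div_mul_one_div]
  exact one_div_le_one_div_of_le (by positivity) h3

lemma ker_int {c : ℝ} (hc : 0 < c) : Integrable (fun y : ℝ => ker (c + y * I)) := by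
  refine Integrable.mono' (integrable_inv_one_add_sq.const_mul _) ?_ (ae_of_all _ (norm_ker_le hc))
  apply Continuous.aestronglyMeasurable
  unfold ker
  refine continuous_const.div (by fun_prop) ?_
  intro y
  exact mul_ne_zero (ker_ne hc y).1 (ker_ne hc y).2

lemma perron0 {c x : ℝ} (hc : 0 < c) (hx : 0 < x) :
    ∫ y : ℝ, (x:ℂ) ^ (-(c + y * I : ℂ)) * ker (c + y * I) = 2 * Real.pi * (max 0 (1 - x) : ℝ) := by
  set f : ℝ → ℂ := fun t => (indicator (Ioc 0 1) (fun _ => 1 : ℝ → ℂ)) t - (indicator (Ioc 0 1) (fun t => (t:ℂ) ^ (1:ℂ) : ℝ → ℂ)) t with hf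
  have hM : ∀ s : ℂ, 0 < s.re → HasMellin f s (ker s) := by
    intro s hs
    have h1 := hasMellin_one_Ioc hs
    have h2 := hasMellin_cpow_Ioc 1 (s := s) (by simp; linarith)
    have h3 := hasMellin_sub h1.1 h2.1
    rw [h1.2, h2.2] at h3
    have : s ≠ 0 := by intro h; rw [h] at hs; simp at hs
    have : s + 1 ≠ 0 := by intro h; have := congrArg re h; simp at this; linarith
    have he : ker s = 1 / s - 1 / (s + 1) := by
      unfold ker; field_simp; ring
    rw [he]; exact h3
  have hfv : ∀ t : ℝ, 0 < t → f t = (max 0 (1 - t) : ℝ) := by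
    intro t ht
    rw [hf]
    by_cases h : t ≤ 1
    · simp only []
      rw [indicator_of_mem (show t ∈ Ioc (0:ℝ) 1 from ⟨ht, h⟩), indicator_of_mem (show t ∈ Ioc (0:ℝ) 1 from ⟨ht, h⟩), max_eq_right (by linarith)]
      simp
    · simp only []
      rw [indicator_of_notMem (fun h' => h h'.2), indicator_of_notMem (fun h' => h h'.2), max_eq_left (by push Not at h; linarith)]
      simp
  have hline : ∀ y : ℝ, mellin f (c + y * I) = ker (c + y * I) := fun y => (hM _ (by simpa using hc)).2
  have hcont : ContinuousAt f x := by
    have : ContinuousAt (fun t : ℝ => ((max 0 (1 - t) : ℝ) : ℂ)) x := by fun_prop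
    refine this.congr ?_
    filter_upwards [lt_mem_nhds hx] with t ht using (hfv t ht).symm
  have := mellinInv_mellin_eq c f hx (hM c (by simpa using hc)).1 (by
    unfold VerticalIntegrable
    simp_rw [hline]
    exact ker_int hc) hcont
  rw [mellinInv, hfv x hx] at this
  simp_rw [hline, smul_eq_mul] at this
  rw [← this]
  rw [real_smul, ← mul_assoc]
  have hpi : (2 * Real.pi : ℂ) ≠ 0 := by simp
  have : 2 * (Real.pi:ℂ) * ((1 / (2 * Real.pi) : ℝ) : ℂ) = 1 := by
    push_cast; field_simp
  rw [this, one_mul]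

/-- the elementary Perron integrand -/
noncomputable def pint (X : ℝ) (w : ℂ) : ℂ := (X:ℂ) ^ (w + 1) * ker w

lemma pint_eq {X m : ℝ} (hX : 0 < X) (hm : 0 < m) (w : ℂ) :
    pint X w * (m:ℂ) ^ (-w) = X * (((m / X : ℝ) : ℂ) ^ (-w) * ker w) := by
  have hX' : (X:ℂ) ≠ 0 := by exact_mod_cast hX.ne'
  rw [pint, ofReal_div, div_cpow_ofReal_nonneg hm.le hX.le, cpow_add _ _ hX', cpow_one, cpow_neg (X:ℂ) w]
  have : (X:ℂ) ^ w ≠ 0 := by simp [cpow_eq_zero_iff, hX']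
  field_simp

lemma perron1 {c X m : ℝ} (hc : 0 < c) (hX : 0 < X) (hm : 0 < m) :
    ∫ y : ℝ, pint X (c + y * I) * (m:ℂ) ^ (-(c + y * I : ℂ)) = 2 * Real.pi * (max 0 (X - m) : ℝ) := by
  simp_rw [pint_eq hX hm]
  rw [integral_const_mul, perron0 hc (div_pos hm hX)]
  have : max 0 (X - m) = X * max 0 (1 - m / X) := by
    rw [mul_max_of_nonneg _ _ hX.le]; congr 1
    · simp
    · field_simp
  rw [this]; push_cast; ring

lemma pint_int {c X : ℝ} (hc : 0 < c) (hX : 0 < X) : Integrable (fun y : ℝ => pint X (c + y * I)) := by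
  have hX' : (X:ℂ) ≠ 0 := by exact_mod_cast hX.ne'
  unfold pint
  refine (ker_int hc).bdd_mul (c := X ^ (c+1)) ?_ (ae_of_all _ fun y => ?_)
  · apply Continuous.aestronglyMeasurable
    exact Continuous.const_cpow (by fun_prop) (Or.inl hX')
  · rw [norm_cpow_eq_rpow_re_of_pos hX]; simp

lemma norm_line_cpow {m c : ℝ} (hm : 0 < m) (y : ℝ) : ‖(m:ℂ) ^ (-(c + y * I : ℂ))‖ = m ^ (-c) := by
  rw [norm_cpow_eq_rpow_re_of_pos hm]; simp

lemma perron_sum {g : ℕ → ℂ} {σ c X : ℝ} (hc : 0 < c) (hX : 0 < X)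
    (hg : LSeriesSummable g ((σ + c : ℝ) : ℂ)) :
    HasSum (fun n : ℕ => LSeries.term g σ n * (2 * Real.pi * (max 0 (X - n) : ℝ)))
      (∫ y : ℝ, LSeries g (σ + (c + y * I)) * pint X (c + y * I)) ∧
    Integrable (fun y : ℝ => LSeries g (σ + (c + y * I)) * pint X (c + y * I)) := by
  set P : ℕ → ℝ → ℂ := fun n y => LSeries.term g (σ + (c + y * I)) n * pint X (c + y * I) with hP
  have hterm : ∀ n : ℕ, n ≠ 0 → ∀ w : ℂ, LSeries.term g (σ + w) n = LSeries.term g σ n * (n:ℂ) ^ (-w) := by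
    intro n hn w
    have : (n:ℂ) ≠ 0 := by exact_mod_cast hn
    rw [LSeries.term_of_ne_zero hn, LSeries.term_of_ne_zero hn, cpow_add _ _ this, cpow_neg]
    rw [div_mul_eq_div_div]; rfl
  have hPe : ∀ n : ℕ, n ≠ 0 → ∀ y, P n y = LSeries.term g σ n * (pint X (c + y * I) * (n:ℂ) ^ (-(c + y * I : ℂ))) := by
    intro n hn y
    simp only [hP]; rw [hterm n hn]; ring
  have hP0 : P 0 = fun _ => 0 := by ext y; simp [hP]
  have hi0 : ∀ n : ℕ, n ≠ 0 → Integrable (fun y : ℝ => pint X (c + y * I) * (n:ℂ) ^ (-(c + y * I : ℂ))) := by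
    intro n hn
    have hn' : (0:ℝ) < n := by positivity
    refine (pint_int hc hX).mul_bdd (c := (n:ℝ) ^ (-c)) ?_ (ae_of_all _ fun y => ?_)
    · apply Continuous.aestronglyMeasurable
      exact Continuous.const_cpow (by fun_prop) (Or.inl (by exact_mod_cast hn))
    · exact (norm_line_cpow hn' y).le
  have hPi : ∀ n, Integrable (P n) := by
    intro n
    rcases eq_or_ne n 0 with rfl | hn
    · rw [hP0]; exact integrable_zero _ _ _
    · have : P n = fun y : ℝ => LSeries.term g σ n * (pint X (c + y * I) * (n:ℂ) ^ (-(c + y * I : ℂ))) := by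
        ext y; exact hPe n hn y
      rw [this]
      exact (hi0 n hn).const_mul _
  have hnorm : ∀ n (y : ℝ), ‖P n y‖ = ‖LSeries.term g ((σ + c : ℝ) : ℂ) n‖ * ‖pint X (c + y * I)‖ := by
    intro n y
    simp only [hP]
    rw [norm_mul, LSeries.norm_term_eq, LSeries.norm_term_eq]
    simp
  have hPs : Summable fun n => ∫ y, ‖P n y‖ := by
    simp_rw [hnorm, integral_const_mul]
    exact hg.norm.mul_right _
  have h := hasSum_integral_of_summable_integral_norm hPi hPs
  have htsum : ∀ y, ∑' n, P n y = LSeries g (σ + (c + y * I)) * pint X (c + y * I) := by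
    intro y
    simp only [hP]
    rw [tsum_mul_right, LSeries]
  simp_rw [htsum] at h
  constructor
  · have hfe : (fun n : ℕ => LSeries.term g σ n * (2 * Real.pi * (max 0 (X - n) : ℝ))) = fun n => ∫ a, P n a := by
      funext n
      rcases eq_or_ne n 0 with rfl | hn
      · simp [hP0]
      · have hn' : (0:ℝ) < n := by positivity
        simp_rw [hPe n hn]
        rw [integral_const_mul]
        congr 1
        have := perron1 (m := n) hc hX hn'
        rw [← this]; simp
    rw [hfe]; exact h
  · have hb : ∀ y : ℝ, ‖LSeries g (σ + (c + y * I))‖ ≤ ∑' n, ‖LSeries.term g ((σ + c : ℝ) : ℂ) n‖ := by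
      intro y
      rw [LSeries]
      refine tsum_of_norm_bounded hg.norm.hasSum fun n => ?_
      rw [LSeries.norm_term_eq, LSeries.norm_term_eq]
      simp
    refine (pint_int hc hX).bdd_mul (c := ∑' n, ‖LSeries.term g ((σ + c : ℝ) : ℂ) n‖) ?_ (ae_of_all _ hb)
    have : (fun y : ℝ => LSeries g (σ + (c + y * I))) = fun y : ℝ => ∑' n, LSeries.term g (σ + (c + y * I)) n := by
      ext y; rw [LSeries]
    rw [this]
    apply Continuous.aestronglyMeasurable
    refine continuous_tsum (u := fun n => ‖LSeries.term g ((σ + c : ℝ) : ℂ) n‖) ?_ hg.norm ?_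
    · intro n
      rcases eq_or_ne n 0 with rfl | hn
      · simp only [LSeries.term_zero]; exact continuous_const
      · have : (n:ℂ) ≠ 0 := by exact_mod_cast hn
        simp_rw [LSeries.term_of_ne_zero hn]
        refine continuous_const.div (Continuous.const_cpow (by fun_prop) (Or.inl this)) ?_
        intro y; simp [cpow_eq_zero_iff, this]
    · intro n y
      rw [LSeries.norm_term_eq, LSeries.norm_term_eq]
      simp

end LDA

namespace LDA
open Complex Metric MeasureTheory Set Filter Asymptotics

/-- the smoothed kernel -/
noncomputable def sker (Y H : ℝ) (w : ℂ) : ℂ := (pint (Y + H) w - pint Y w) / H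

lemma LD_eq_LSeries {q : ℕ} [NeZero q] (χ : DirichletCharacter ℂ q) {s : ℂ} (hs : 1 < s.re) :
    LSeries ((fun n : ℕ => χ n) * (fun n : ℕ => (ArithmeticFunction.vonMangoldt n : ℂ))) s = - LD χ s := by
  rw [DirichletCharacter.LSeries_twist_vonMangoldt_eq χ hs, LD,
    DirichletCharacter.deriv_LFunction_eq_deriv_LSeries χ hs, DirichletCharacter.LFunction_eq_LSeries χ hs, neg_div]

lemma sker_integral {c Y H : ℝ} (hc : 0 < c) (hY : 1 ≤ Y) (hH : 0 < H) :
    Integrable (fun y : ℝ => sker Y H (c + y * I)) ∧ ∫ y : ℝ, sker Y H (c + y * I) = 2 * Real.pi := by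
  have hY0 : 0 < Y := by linarith
  have h1 := pint_int hc hY0
  have h2 := pint_int (X := Y + H) hc (by linarith)
  refine ⟨(h2.sub h1).div_const _, ?_⟩
  unfold sker
  rw [integral_div, integral_sub h2 h1]
  have e1 := perron1 (m := 1) hc hY0 one_pos
  have e2 := perron1 (X := Y + H) (m := 1) hc (by linarith) one_pos
  simp only [ofReal_one, one_cpow, mul_one] at e1 e2
  rw [e1, e2, max_eq_right (by linarith), max_eq_right (by linarith)]
  have : (H:ℂ) ≠ 0 := by exact_mod_cast hH.ne'
  push_cast
  field_simp
  ring

lemma perron_main {q : ℕ} [NeZero q] (χ : DirichletCharacter ℂ q) {σ c Y H : ℝ}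
    (hc : 0 < c) (hσc : 1 < σ + c) (hY : 1 ≤ Y) (hH : 0 < H) :
    Integrable (fun y : ℝ => (LD χ σ - LD χ (σ + (c + y * I))) * sker Y H (c + y * I)) ∧
    ‖-LD χ σ - ∑ n ∈ Finset.Icc 1 ⌊Y⌋₊, (ArithmeticFunction.vonMangoldt n : ℂ) * χ n / (n : ℂ) ^ (σ : ℂ)‖ ≤
      ‖∫ y : ℝ, (LD χ σ - LD χ (σ + (c + y * I))) * sker Y H (c + y * I)‖ / (2 * Real.pi)
      + ∑ n ∈ Finset.Ioc ⌊Y⌋₊ ⌊Y + H⌋₊, ArithmeticFunction.vonMangoldt n / (n:ℝ) ^ σ := by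
  have hY0 : 0 < Y := by linarith
  have hHc : (H:ℂ) ≠ 0 := by exact_mod_cast hH.ne'
  set g : ℕ → ℂ := (fun n : ℕ => χ n) * (fun n : ℕ => (ArithmeticFunction.vonMangoldt n : ℂ)) with hg
  have hgs : LSeriesSummable g ((σ + c : ℝ) : ℂ) :=
    DirichletCharacter.LSeriesSummable_twist_vonMangoldt χ (by simpa using hσc)
  obtain ⟨s1, i1⟩ := perron_sum hc hY0 hgs
  obtain ⟨s2, i2⟩ := perron_sum (X := Y + H) hc (by linarith) hgs
  obtain ⟨i3, e3⟩ := sker_integral hc hY hH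
  have hL : ∀ y : ℝ, LSeries g (σ + (c + y * I)) = - LD χ (σ + (c + y * I)) := fun y =>
    LD_eq_LSeries χ (by simpa using hσc)
  simp_rw [hL] at s1 i1 s2 i2
  have i4 := ((i2.sub i1).div_const (H:ℂ)).add (i3.const_mul (LD χ σ))
  have hfe : (fun y : ℝ => (LD χ σ - LD χ (σ + (c + y * I))) * sker Y H (c + y * I)) =
    fun y : ℝ => ((-LD χ (σ + (c + y * I)) * pint (Y+H) (c + y * I) - -LD χ (σ + (c + y * I)) * pint Y (c + y * I)) / H
      + LD χ σ * sker Y H (c + y * I)) := by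
    ext y; unfold sker; ring
  rw [hfe]
  refine ⟨i4, ?_⟩
  have hI : ∫ y : ℝ, ((-LD χ (σ + (c + y * I)) * pint (Y+H) (c + y * I) - -LD χ (σ + (c + y * I)) * pint Y (c + y * I)) / H
      + LD χ σ * sker Y H (c + y * I)) = ((∫ y : ℝ, -LD χ (σ + (c + y * I)) * pint (Y+H) (c + y * I)) - ∫ y : ℝ, -LD χ (σ + (c + y * I)) * pint Y (c + y * I)) / H
      + LD χ σ * (2 * Real.pi) := by
    have i5 : Integrable (fun y : ℝ => (-LD χ (σ + (c + y * I)) * pint (Y+H) (c + y * I) - -LD χ (σ + (c + y * I)) * pint Y (c + y * I)) / (H:ℂ)) :=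
      (i2.sub i1).div_const (H:ℂ)
    rw [integral_add i5 (i3.const_mul (LD χ σ)), integral_const_mul, e3, integral_div, integral_sub i2 i1]
  rw [hI]
  have s3 := (s2.sub s1).div_const (H:ℂ)
  set m : ℕ → ℝ := fun n => (max 0 (Y + H - n) - max 0 (Y - n)) / H with hm
  have s4 : HasSum (fun n : ℕ => (2 * Real.pi) * (LSeries.term g σ n * (m n : ℂ))) (((∫ y : ℝ, -LD χ (σ + (c + y * I)) * pint (Y+H) (c + y * I)) - ∫ y : ℝ, -LD χ (σ + (c + y * I)) * pint Y (c + y * I)) / H) := by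
    have : (fun n : ℕ => (2 * Real.pi) * (LSeries.term g σ n * (m n : ℂ))) = fun n : ℕ => (LSeries.term g σ n * (2 * Real.pi * (max 0 (Y + H - n) : ℝ)) - LSeries.term g σ n * (2 * Real.pi * (max 0 (Y - n) : ℝ))) / H := by
      funext n
      simp only [hm]
      push_cast
      ring
    rw [this]; exact s3
  have hm0 : ∀ n : ℕ, ⌊Y + H⌋₊ < n → m n = 0 := by
    intro n hn
    have := (Nat.floor_lt (by linarith)).mp hn
    simp only [hm]
    rw [max_eq_left (by linarith), max_eq_left (by linarith)]; simp
  have hm1 : ∀ n : ℕ, n ≤ ⌊Y⌋₊ → m n = 1 := by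
    intro n hn
    have := (Nat.le_floor_iff (by linarith)).mp hn
    simp only [hm]
    rw [max_eq_right (by linarith), max_eq_right (by linarith)]
    field_simp; ring
  have hm2 : ∀ n : ℕ, |m n| ≤ 1 := by
    intro n
    simp only [hm]
    rw [abs_div, abs_of_pos hH, div_le_one hH, abs_le]
    constructor
    · have : max 0 (Y - n) ≤ max 0 (Y + H - n) := max_le_max le_rfl (by linarith)
      linarith
    · have : max 0 (Y + H - n) ≤ max 0 (Y - n) + H := by
        apply max_le
        · linarith [le_max_left 0 (Y - n)]
        · linarith [le_max_right 0 (Y - n)]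
      linarith
  have s5 := s4.unique (hasSum_sum_of_ne_finset_zero (s := Finset.Icc 1 ⌊Y + H⌋₊) (by
    intro n hn
    rw [Finset.mem_Icc, not_and_or] at hn
    rcases hn with hn | hn
    · have : n = 0 := by omega
      simp [this]
    · rw [hm0 n (by omega)]; simp))
  rw [s5, ← Finset.mul_sum]
  have hNN : ⌊Y⌋₊ ≤ ⌊Y + H⌋₊ := Nat.floor_mono (by linarith)
  have hsplit : ∑ n ∈ Finset.Icc 1 ⌊Y + H⌋₊, LSeries.term g σ n * (m n : ℂ) =
      ∑ n ∈ Finset.Icc 1 ⌊Y⌋₊, LSeries.term g σ n * (m n : ℂ) + ∑ n ∈ Finset.Ioc ⌊Y⌋₊ ⌊Y+H⌋₊, LSeries.term g σ n * (m n : ℂ) := by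
    rw [← Finset.sum_union]
    · congr 1
      ext n
      simp only [Finset.mem_Icc, Finset.mem_union, Finset.mem_Ioc]
      omega
    · rw [Finset.disjoint_left]
      intro n
      simp only [Finset.mem_Icc, Finset.mem_Ioc]
      omega
  have hfirst : ∑ n ∈ Finset.Icc 1 ⌊Y⌋₊, LSeries.term g σ n * (m n : ℂ) = ∑ n ∈ Finset.Icc 1 ⌊Y⌋₊, (ArithmeticFunction.vonMangoldt n : ℂ) * χ n / (n : ℂ) ^ (σ : ℂ) := by
    apply Finset.sum_congr rfl
    intro n hn
    rw [Finset.mem_Icc] at hn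
    rw [hm1 n hn.2, LSeries.term_of_ne_zero (by omega)]
    simp [hg, mul_comm]
  rw [hsplit, hfirst]
  set A := ∑ n ∈ Finset.Icc 1 ⌊Y⌋₊, (ArithmeticFunction.vonMangoldt n : ℂ) * χ n / (n : ℂ) ^ (σ : ℂ)
  set E := ∑ n ∈ Finset.Ioc ⌊Y⌋₊ ⌊Y+H⌋₊, LSeries.term g σ n * (m n : ℂ)
  have hE : ‖E‖ ≤ ∑ n ∈ Finset.Ioc ⌊Y⌋₊ ⌊Y + H⌋₊, ArithmeticFunction.vonMangoldt n / (n:ℝ) ^ σ := by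
    refine (norm_sum_le _ _).trans (Finset.sum_le_sum fun n hn => ?_)
    rw [Finset.mem_Ioc] at hn
    have hn0 : n ≠ 0 := by omega
    rw [norm_mul, norm_real, Real.norm_eq_abs, LSeries.norm_term_eq, if_neg hn0]
    have hv : ‖g n‖ ≤ ArithmeticFunction.vonMangoldt n := by
      simp only [hg, Pi.mul_apply, norm_mul, norm_real, Real.norm_eq_abs, abs_of_nonneg (ArithmeticFunction.vonMangoldt_nonneg (n := n))]
      exact mul_le_of_le_one_left ArithmeticFunction.vonMangoldt_nonneg (χ.norm_le_one _)
    calc _ ≤ ‖g n‖ / (n:ℝ) ^ (σ:ℂ).re * 1 := by gcongr; exact hm2 n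
      _ ≤ _ := by rw [mul_one, ofReal_re]; gcongr
  have hpi : 0 < 2 * Real.pi := by positivity
  have e5 : 2 * (Real.pi:ℂ) * (A + E) + LD χ σ * (2 * Real.pi) = ((2 * Real.pi : ℝ) : ℂ) * (A + E + LD χ σ) := by
    push_cast; ring
  rw [e5, norm_mul, norm_real, Real.norm_of_nonneg hpi.le, mul_div_cancel_left₀ _ hpi.ne']
  calc _ = ‖(-(A + E + LD χ σ)) + E‖ := by congr 1; ring
    _ ≤ ‖-(A + E + LD χ σ)‖ + ‖E‖ := norm_add_le _ _
    _ ≤ _ := by rw [norm_neg]; gcongr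

end LDA

namespace LDA
open Complex Metric MeasureTheory Set Filter Asymptotics

lemma tail_bound {f : ℝ → ℂ} (hf : Integrable f) {T D : ℝ} (hT : 0 < T)
    (hb : ∀ y, T ≤ |y| → ‖f y‖ ≤ D / y ^ 2) :
    ‖∫ y, f y‖ ≤ ‖∫ y in (-T)..T, f y‖ + 2 * (D / T) := by
  have h1 : ∀ g : ℝ → ℂ, Integrable g → (∀ y, T ≤ |y| → ‖g y‖ ≤ D / y ^ 2) → ‖∫ y in Ioi T, g y‖ ≤ D / T := by
    intro g hg hgb
    have hi := (integrableOn_Ioi_rpow_of_lt (a := -2) (by norm_num) hT).const_mul D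
    have : ‖∫ y in Ioi T, g y‖ ≤ ∫ y in Ioi T, D * y ^ (-2:ℝ) := by
      refine norm_integral_le_of_norm_le hi ?_
      filter_upwards [ae_restrict_mem measurableSet_Ioi] with y hy
      have hy' : T < y := hy
      have hy0 : 0 < y := hT.trans hy'
      refine (hgb y (by rw [abs_of_pos hy0]; exact hy'.le)).trans (le_of_eq ?_)
      rw [Real.rpow_neg hy0.le, Real.rpow_two]; rfl
    rw [integral_const_mul, integral_Ioi_rpow_of_lt (by norm_num) hT] at this
    refine this.trans (le_of_eq ?_)
    rw [show (-2:ℝ) + 1 = -1 by norm_num, Real.rpow_neg_one]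
    field_simp
  have h2 : ‖∫ y in Iic (-T), f y‖ ≤ D / T := by
    have := h1 (fun y => f (-y)) hf.comp_neg (fun y hy => by
      have := hb (-y) (by rwa [abs_neg]); simpa using this)
    rw [integral_comp_neg_Ioi] at this
    exact this
  have h3 := h1 f hf hb
  have e1 := intervalIntegral.integral_Iic_sub_Iic (a := -T) (b := T) hf.integrableOn hf.integrableOn
  have e2 := intervalIntegral.integral_Iic_add_Ioi (b := T) hf.integrableOn hf.integrableOn
  rw [← e2, sub_eq_iff_eq_add.mp e1]
  calc _ ≤ ‖(∫ y in (-T)..T, f y) + ∫ y in Iic (-T), f y‖ + ‖∫ y in Ioi T, f y‖ := norm_add_le _ _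
    _ ≤ ‖(∫ y in (-T)..T, f y)‖ + ‖∫ y in Iic (-T), f y‖ + ‖∫ y in Ioi T, f y‖ := by gcongr; exact norm_add_le _ _
    _ ≤ _ := by linarith

lemma line_split {f : ℝ → ℂ} {T : ℕ} (hT : 1 ≤ T) {D : ℝ}
    (hD : 0 ≤ D) (hf : ContinuousOn f (Icc (-T) T))
    (h1 : ∀ k : ℕ, 1 ≤ k → k < T → ‖∫ y in (k:ℝ)..k+1, f y‖ ≤ D / k)
    (h2 : ∀ k : ℕ, 1 ≤ k → k < T → ‖∫ y in (-(k+1) : ℝ)..(-(k+1)+1), f y‖ ≤ D / k) :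
    ‖∫ y in (-T:ℝ)..T, f y‖ ≤ ‖∫ y in (-1:ℝ)..1, f y‖ + 2 * D * (1 + Real.log T) := by
  have key : ∀ N : ℕ, 1 ≤ N → N ≤ T → ‖∫ y in (-N:ℝ)..N, f y‖ ≤ ‖∫ y in (-1:ℝ)..1, f y‖ + ∑ k ∈ Finset.Ico 1 N, 2 * D * (k:ℝ)⁻¹ := by
    intro N hN
    induction N, hN using Nat.le_induction with
    | base => intro _; simp
    | succ N hN ih =>
      intro hNT
      have hNT' : ((N+1:ℕ):ℝ) ≤ T := by exact_mod_cast hNT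
      push_cast at hNT'
      have hN0 : (0:ℝ) ≤ N := by positivity
      have hIntg : ∀ a b : ℝ, -T ≤ a → a ≤ b → b ≤ T → IntervalIntegrable f volume a b := by
        intro a b ha hab hb
        apply (hf.mono _).intervalIntegrable
        rw [uIcc_of_le hab]
        exact Icc_subset_Icc ha hb
      have e : ∫ y in (-((N+1:ℕ):ℝ))..((N+1:ℕ):ℝ), f y = (∫ y in (-(N+1) : ℝ)..(-(N+1)+1), f y) + (∫ y in (-N:ℝ)..N, f y) + ∫ y in (N:ℝ)..N+1, f y := by
        push_cast
        rw [show (-((N:ℝ)+1)+1) = -N by ring]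
        rw [intervalIntegral.integral_add_adjacent_intervals (hIntg _ _ (by linarith) (by linarith) (by linarith)) (hIntg _ _ (by linarith) (by linarith) (by linarith)),
          intervalIntegral.integral_add_adjacent_intervals (hIntg _ _ (by linarith) (by linarith) (by linarith)) (hIntg _ _ (by linarith) (by linarith) (by linarith))]
      rw [e, Finset.sum_Ico_succ_top hN]
      have a1 := h1 N hN (by omega)
      have a2 := h2 N hN (by omega)
      have a3 := ih (by omega)
      rw [div_eq_mul_inv] at a1 a2
      calc _ ≤ _ := norm_add₃_le
        _ ≤ _ := by linarith
  refine (key T hT le_rfl).trans ?_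
  gcongr
  rw [← Finset.mul_sum]
  gcongr
  have hh := harmonic_le_one_add_log T
  rw [harmonic_eq_sum_Icc] at hh
  push_cast at hh
  refine le_trans (Finset.sum_le_sum_of_subset_of_nonneg ?_ ?_) hh
  · intro k; simp only [Finset.mem_Ico, Finset.mem_Icc]; omega
  · intro k _ _; positivity

lemma LD_right {q : ℕ} [NeZero q] (χ : DirichletCharacter ℂ q) {δ : ℝ} (hδ : 0 < δ) (hδ1 : δ ≤ 1) {s : ℂ}
    (hs : s.re = 1 + δ) : ‖LD χ s‖ ≤ 6 / δ ^ 2 := by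
  have hs1 : 1 < s.re := by linarith
  rw [← norm_neg, ← LD_eq_LSeries χ hs1, LSeries]
  have hz := ZetaAsymptotics.zeta_limit_aux1 (s := 1 + δ / 2) (by linarith)
  have hT : 0 ≤ ZetaAsymptotics.termTSum (1 + δ/2) := by
    unfold ZetaAsymptotics.termTSum
    exact tsum_nonneg fun n => ZetaAsymptotics.term_nonneg _ _
  have hsum : Summable (fun n : ℕ => 1 / (n:ℝ) ^ (1 + δ/2)) := Real.summable_one_div_nat_rpow.mpr (by linarith)
  have hval : ∑' n : ℕ, 1 / (n:ℝ) ^ (1 + δ/2) ≤ 3 / δ := by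
    rw [hsum.tsum_eq_zero_add]
    have h0 : (1:ℝ) / ((0:ℕ):ℝ) ^ (1 + δ/2) = 0 := by
      rw [Nat.cast_zero, Real.zero_rpow (by linarith)]; simp
    rw [h0, zero_add]
    push_cast
    have : (1 + δ/2 - 1) = δ / 2 := by ring
    rw [this] at hz
    have h3 : ∑' n : ℕ, 1 / ((n:ℝ) + 1) ^ (1 + δ/2) ≤ 1 + 1 / (δ/2) := by
      nlinarith
    refine h3.trans ?_
    rw [le_div_iff₀ hδ]; field_simp; linarith
  have hb := (hsum.mul_left (2 / δ)).hasSum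
  rw [tsum_mul_left] at hb
  refine (tsum_of_norm_bounded hb fun n => ?_).trans ?_
  · rw [LSeries.norm_term_eq]
    split_ifs with hn
    · positivity
    · have hn1 : (1:ℝ) ≤ n := by exact_mod_cast Nat.one_le_iff_ne_zero.mpr hn
      have hn0 : (0:ℝ) < n := by linarith
      have hv : ‖((fun n : ℕ => χ n) * (fun n : ℕ => (ArithmeticFunction.vonMangoldt n : ℂ))) n‖ ≤ (n:ℝ) ^ (δ/2) / (δ/2) := by
        simp only [Pi.mul_apply, norm_mul, norm_real, Real.norm_eq_abs, abs_of_nonneg (ArithmeticFunction.vonMangoldt_nonneg (n := n))]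
        calc _ ≤ 1 * Real.log n := by
              gcongr
              · exact χ.norm_le_one _
              · exact ArithmeticFunction.vonMangoldt_le_log
          _ ≤ _ := by rw [one_mul]; exact Real.log_le_rpow_div hn0.le (by positivity)
      calc _ ≤ (n:ℝ) ^ (δ/2) / (δ/2) / (n:ℝ) ^ s.re := by gcongr
        _ = _ := by
          rw [hs, show 1 + δ = (1 + δ/2) + δ/2 by ring, Real.rpow_add hn0 (1 + δ/2)]
          have : (0:ℝ) < (n:ℝ) ^ (δ/2) := by positivity
          field_simp
  · calc 2 / δ * ∑' n : ℕ, 1 / (n:ℝ) ^ (1 + δ/2) ≤ 2 / δ * (3 / δ) := by gcongr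
      _ = _ := by field_simp; norm_num

/-- the numerator of the smoothed kernel -/
noncomputable def Bf (Y H : ℝ) (w : ℂ) : ℂ := (((Y + H : ℝ) : ℂ) ^ (w + 1) - (Y : ℂ) ^ (w + 1)) / H

/-- its antiderivative -/
noncomputable def Af (Y H : ℝ) (w : ℂ) : ℂ :=
  (((Y + H : ℝ) : ℂ) ^ (w + 1) / Real.log (Y + H) - (Y : ℂ) ^ (w + 1) / Real.log Y) / H

lemma sker_eq (Y H : ℝ) (w : ℂ) : sker Y H w = Bf Y H w * ker w := by
  unfold sker pint Bf; ring

lemma cpow_hasDeriv {x : ℝ} (hx : 0 < x) (w : ℂ) :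
    HasDerivAt (fun w : ℂ => (x:ℂ) ^ (w + 1)) ((x:ℂ) ^ (w + 1) * Real.log x) w := by
  have hx' : (x:ℂ) ≠ 0 := by exact_mod_cast hx.ne'
  have := ((hasDerivAt_id w).add_const 1).const_cpow (c := (x:ℂ)) (Or.inl hx')
  simpa [ofReal_log hx.le] using this

lemma Bf_diff {Y H : ℝ} (hY : 0 < Y) (hH : 0 < H) : Differentiable ℂ (Bf Y H) := fun w =>
  (((cpow_hasDeriv (by linarith : 0 < Y + H) w).sub (cpow_hasDeriv hY w)).div_const (H:ℂ)).differentiableAt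

lemma Af_deriv {Y H : ℝ} (hY : 1 < Y) (hH : 0 < H) (w : ℂ) : HasDerivAt (Af Y H) (Bf Y H w) w := by
  have h1 : ((Real.log Y : ℝ) : ℂ) ≠ 0 := by exact_mod_cast (Real.log_pos hY).ne'
  have h2 : ((Real.log (Y + H) : ℝ) : ℂ) ≠ 0 := by exact_mod_cast (Real.log_pos (by linarith : 1 < Y + H)).ne'
  have := ((((cpow_hasDeriv (by linarith : 0 < Y + H) w).div_const ((Real.log (Y + H) : ℝ) : ℂ))).sub
    ((cpow_hasDeriv (by linarith : 0 < Y) w).div_const ((Real.log Y : ℝ) : ℂ))).div_const (H:ℂ)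
  refine this.congr_deriv ?_
  unfold Bf
  rw [mul_div_cancel_right₀ _ h1, mul_div_cancel_right₀ _ h2]

lemma cpow_hasDeriv_base {x : ℝ} (hx : 0 < x) {w : ℂ} (hw : w + 1 ≠ 0) :
    HasDerivAt (fun x : ℝ => (x:ℂ) ^ (w + 1)) ((w + 1) * (x:ℂ) ^ w) x := by
  have := hasDerivAt_ofReal_cpow_const hx.ne' (r := w + 1) hw
  rwa [add_sub_cancel_right] at this

lemma norm_cpow_line {Y x e : ℝ} (hY : 0 < Y) (hx : Y ≤ x) (he : 0 ≤ e) {w : ℂ} (hw : w.re = -e) :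
    ‖(x:ℂ) ^ w‖ ≤ Y ^ (-e) := by
  rw [norm_cpow_eq_rpow_re_of_pos (by linarith), hw]
  exact Real.rpow_le_rpow_of_nonpos hY hx (by linarith)

lemma Bf_le {Y H e : ℝ} (hY : 0 < Y) (hH : 0 < H) (he : 0 ≤ e) {w : ℂ} (hw : w.re = -e) (hw1 : w + 1 ≠ 0) :
    ‖Bf Y H w‖ ≤ ‖w + 1‖ * Y ^ (-e) := by
  have := (convex_Icc Y (Y + H)).norm_image_sub_le_of_norm_hasDerivWithin_le (𝕜 := ℝ)
    (f := fun x : ℝ => (x:ℂ) ^ (w + 1)) (f' := fun x : ℝ => (w + 1) * (x:ℂ) ^ w) (C := ‖w + 1‖ * Y ^ (-e)) (x := Y) (y := Y + H)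
    (fun x hx => (cpow_hasDeriv_base (by linarith [hx.1]) hw1).hasDerivWithinAt)
    (fun x hx => by rw [norm_mul]; gcongr; exact norm_cpow_line hY hx.1 he hw)
    (by simp; linarith) (by simp; linarith)
  rw [Bf, norm_div, norm_real, Real.norm_of_nonneg hH.le, div_le_iff₀ hH]
  simpa [abs_of_pos hH] using this

lemma Af_le {Y H e : ℝ} (hY : 1 ≤ Real.log Y) (hY1 : 1 < Y) (hH : 0 < H) (he : 0 ≤ e) {w : ℂ} (hw : w.re = -e) (hw1 : w + 1 ≠ 0) :
    ‖Af Y H w‖ ≤ (‖w + 1‖ + 1) * Y ^ (-e) / Real.log Y := by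
  have hY0 : 0 < Y := by linarith
  have hlog : ∀ x, Y ≤ x → Real.log Y ≤ Real.log x := fun x hx => Real.log_le_log hY0 hx
  have := (convex_Icc Y (Y + H)).norm_image_sub_le_of_norm_hasDerivWithin_le (𝕜 := ℝ)
    (f := fun x : ℝ => (x:ℂ) ^ (w + 1) / ((Real.log x : ℝ) : ℂ)) (f' := fun x : ℝ => ((w + 1) * (x:ℂ) ^ w * ((Real.log x : ℝ) : ℂ) - (x:ℂ) ^ (w+1) * ((x⁻¹ : ℝ) : ℂ)) / ((Real.log x : ℝ) : ℂ)^2) (C := (‖w + 1‖ + 1) * Y ^ (-e) / Real.log Y) (x := Y) (y := Y + H)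
    (fun x hx => by
      have hx0 : 0 < x := by linarith [hx.1]
      have hl : ((Real.log x : ℝ) : ℂ) ≠ 0 := by
        have := hlog x hx.1
        exact_mod_cast (by linarith : (0:ℝ) < Real.log x).ne'
      exact ((cpow_hasDeriv_base hx0 hw1).div (Real.hasDerivAt_log hx0.ne').ofReal_comp hl).hasDerivWithinAt)
    (fun x hx => by
      have hx0 : 0 < x := by linarith [hx.1]
      have hxc : (x:ℂ) ≠ 0 := by exact_mod_cast hx0.ne'
      have hl := hlog x hx.1
      have hb := norm_cpow_line hY0 hx.1 he hw
      have e1 : (x:ℂ) ^ (w+1) * ((x⁻¹ : ℝ) : ℂ) = (x:ℂ) ^ w := by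
        rw [cpow_add _ _ hxc, cpow_one]; push_cast; field_simp
      rw [e1, norm_div, norm_pow, norm_real, Real.norm_of_nonneg (by linarith)]
      have hl0 : 0 < Real.log x := by linarith
      calc _ ≤ (‖w+1‖ * Y ^ (-e) * Real.log x + Y ^ (-e) * Real.log x) / Real.log x ^ 2 := by
            gcongr
            refine (norm_sub_le _ _).trans ?_
            rw [norm_mul, norm_mul, norm_real, Real.norm_of_nonneg hl0.le]
            have : (0:ℝ) ≤ Y ^ (-e) := by positivity
            gcongr
            exact hb.trans (le_mul_of_one_le_right this (by linarith))
        _ = (‖w + 1‖ + 1) * Y ^ (-e) / Real.log x := by field_simp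
        _ ≤ _ := by gcongr)
    (by simp; linarith) (by simp; linarith)
  rw [Af, norm_div, norm_real, Real.norm_of_nonneg hH.le, div_le_iff₀ hH]
  simpa [abs_of_pos hH] using this

end LDA

namespace LDA
open Complex Metric MeasureTheory Set Filter Asymptotics

/-- the integrand -/
noncomputable def Phi {q : ℕ} [NeZero q] (χ : DirichletCharacter ℂ q) (σ Y H : ℝ) (w : ℂ) : ℂ :=
  (LD χ σ - LD χ (σ + w)) * sker Y H w

lemma contour {q : ℕ} [NeZero q] {χ : DirichletCharacter ℂ q} (hχ : χ ≠ 1) {σ Y H e c T : ℝ}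
    (hY : 0 < Y) (hH : 0 < H) (he : 0 < e) (he1 : e < 1) (hc : 0 < c) (hT : 0 < T)
    (hL : ∀ w : ℂ, -e ≤ w.re → |w.im| ≤ T → DirichletCharacter.LFunction χ (σ + w) ≠ 0) :
    ‖∫ y in (-T)..T, Phi χ σ Y H (c + y * I)‖ ≤ ‖∫ y in (-T)..T, Phi χ σ Y H ((-e : ℝ) + y * I)‖
      + ‖∫ x in (-e)..c, Phi χ σ Y H (x + (-T : ℝ) * I)‖ + ‖∫ x in (-e)..c, Phi χ σ Y H (x + T * I)‖ := by
  set F : ℂ → ℂ := fun w => LD χ (σ + w) with hF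
  set J : ℂ → ℂ := fun w => -(dslope F 0 w) * (Bf Y H w / (w + 1)) with hJ
  have hJe : ∀ w : ℂ, w ≠ 0 → J w = Phi χ σ Y H w := by
    intro w hw
    simp only [hJ]
    rw [dslope_of_ne _ hw, slope_def_field, Phi, sker_eq, ker]
    simp only [hF, add_zero, sub_zero]
    by_cases h1 : w + 1 = 0
    · rw [h1]; simp
    · field_simp; ring
  set U : Set ℂ := {w | DirichletCharacter.LFunction χ (σ + w) ≠ 0} with hU
  have hUo : IsOpen U := (L_open hχ).preimage (f := fun w : ℂ => σ + w) (by fun_prop)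
  have hFd : DifferentiableOn ℂ F U := by
    apply (LD_diff hχ).comp (differentiable_id.const_add (σ:ℂ)).differentiableOn
    intro w hw; exact hw
  have h0U : U ∈ nhds (0:ℂ) := hUo.mem_nhds (hL 0 (by simp; linarith) (by simp; linarith))
  have hdd : DifferentiableOn ℂ (dslope F 0) U := (differentiableOn_dslope h0U).mpr hFd
  have hrect : DifferentiableOn ℂ J (uIcc (-e) c ×ℂ uIcc (-T) T) := by
    intro w hw
    rw [mem_reProdIm, uIcc_of_le (by linarith), uIcc_of_le (by linarith)] at hw
    have hw1 : w + 1 ≠ 0 := by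
      intro h; have := congrArg re h; simp at this; linarith [hw.1.1]
    have hwU : w ∈ U := hL w hw.1.1 (abs_le.mpr hw.2)
    apply DifferentiableAt.differentiableWithinAt
    refine DifferentiableAt.mul ((hdd w hwU).differentiableAt (hUo.mem_nhds hwU)).neg ?_
    exact (Bf_diff hY hH w).div (by fun_prop) hw1
  have key := integral_boundary_rect_eq_zero_of_differentiableOn J ⟨-e, -T⟩ ⟨c, T⟩ hrect
  simp only [] at key
  have e1 : ∫ y in (-T)..T, J (c + y * I) = ∫ y in (-T)..T, Phi χ σ Y H (c + y * I) := by
    congr 1; ext y; apply hJe; intro h; have := congrArg re h; simp at this; linarith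
  have e2 : ∫ y in (-T)..T, J ((-e:ℝ) + y * I) = ∫ y in (-T)..T, Phi χ σ Y H ((-e:ℝ) + y * I) := by
    congr 1; ext y; apply hJe; intro h; have := congrArg re h; simp at this; linarith
  have e3 : ∫ x in (-e)..c, J (x + (-T:ℝ) * I) = ∫ x in (-e)..c, Phi χ σ Y H (x + (-T:ℝ) * I) := by
    congr 1; ext y; apply hJe; intro h; have := congrArg im h; simp at this; linarith
  have e4 : ∫ x in (-e)..c, J (x + T * I) = ∫ x in (-e)..c, Phi χ σ Y H (x + T * I) := by
    congr 1; ext y; apply hJe; intro h; have := congrArg im h; simp at this; linarith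
  rw [e1, e2, e3, e4] at key
  set a1 := ∫ y in (-T)..T, Phi χ σ Y H (c + y * I)
  set a2 := ∫ y in (-T)..T, Phi χ σ Y H ((-e:ℝ) + y * I)
  set a3 := ∫ x in (-e)..c, Phi χ σ Y H (x + (-T:ℝ) * I)
  set a4 := ∫ x in (-e)..c, Phi χ σ Y H (x + T * I)
  have : I • a1 = I • a2 + (a4 - a3) := by
    linear_combination key
  calc ‖a1‖ = ‖I • a1‖ := by simp
    _ = ‖I • a2 + (a4 - a3)‖ := by rw [this]
    _ ≤ ‖I • a2‖ + (‖a4‖ + ‖a3‖) := (norm_add_le _ _).trans (by gcongr; exact norm_sub_le _ _)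
    _ = _ := by simp; ring

lemma ker_hasDeriv {w : ℂ} (h0 : w ≠ 0) (h1 : w + 1 ≠ 0) :
    HasDerivAt ker (-(2 * w + 1) / (w * (w + 1)) ^ 2) w := by
  have h := (((hasDerivAt_id w).mul ((hasDerivAt_id w).add_const 1)).fun_inv (mul_ne_zero h0 h1))
  have hk : ker = fun w => (w * (w + 1))⁻¹ := by ext w; unfold ker; rw [one_div]
  rw [hk]
  refine h.congr_deriv ?_
  simp only [id]
  congr 1
  ring

lemma ibp_block {q : ℕ} [NeZero q] {χ : DirichletCharacter ℂ q} (hχ : χ ≠ 1) {σ Y H e a m S : ℝ}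
    (hY : 1 ≤ Real.log Y) (hY1 : 1 < Y) (hH : 0 < H) (he : 0 < e) (hm : 1 ≤ m)
    (hma : ∀ y ∈ Icc a (a+1), m ≤ |y|)
    (hL : ∀ y ∈ Icc a (a+1), DirichletCharacter.LFunction χ (σ + ((-e:ℝ) + y * I)) ≠ 0)
    (hS : ∀ y ∈ Icc a (a+1), ‖LD χ σ - LD χ (σ + ((-e:ℝ) + y * I))‖ ≤ S)
    (hS' : ∫ y in a..a+1, ‖deriv (LD χ) (σ + ((-e:ℝ) + y * I))‖ ≤ S) :
    ‖∫ y in a..a+1, Phi χ σ Y H ((-e:ℝ) + y * I)‖ ≤ 10 * S * (Y ^ (-e) / (Real.log Y * m)) := by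
  have hY0 : 0 < Y := by linarith
  set p : ℝ → ℂ := fun y => ((-e:ℝ):ℂ) + y * I with hp
  have hpd : ∀ y, HasDerivAt p I y := by
    intro y
    have := ((ofRealCLM.hasDerivAt (x := y)).mul_const I).const_add ((-e:ℝ):ℂ)
    exact this.congr_deriv (by simp)
  have hab : a ≤ a + 1 := by linarith
  have hre : ∀ y, (p y).re = -e := by intro y; simp [hp]
  have him : ∀ y, (p y).im = y := by intro y; simp [hp]
  have hnp : ∀ y ∈ Icc a (a+1), m ≤ ‖p y‖ := by
    intro y hy
    have := abs_im_le_norm (p y)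
    rw [him] at this
    exact (hma y hy).trans this
  have hnp1 : ∀ y ∈ Icc a (a+1), m ≤ ‖p y + 1‖ := by
    intro y hy
    have := abs_im_le_norm (p y + 1)
    rw [add_im, him, one_im, add_zero] at this
    exact (hma y hy).trans this
  have hp0 : ∀ y ∈ Icc a (a+1), p y ≠ 0 := fun y hy h => by
    have := hnp y hy; rw [h, norm_zero] at this; linarith
  have hp1 : ∀ y ∈ Icc a (a+1), p y + 1 ≠ 0 := fun y hy h => by
    have := hnp1 y hy; rw [h, norm_zero] at this; linarith
  set Q := Y ^ (-e) / (Real.log Y * m) with hQ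
  have hQ0 : 0 ≤ Q := by positivity
  have hYe : 0 ≤ Y ^ (-e) := by positivity
  have hS0 : 0 ≤ S := (norm_nonneg _).trans (hS a ⟨le_rfl, hab⟩)
  have hAk : ∀ y ∈ Icc a (a+1), ‖ker (p y)‖ * ‖Af Y H (p y)‖ ≤ 2 * Q := by
    intro y hy
    have h1 := Af_le hY hY1 hH he.le (hre y) (hp1 y hy)
    have h2 := hnp y hy
    have h3 := hnp1 y hy
    have h30 : 0 < ‖p y + 1‖ := by linarith
    have h20 : 0 < ‖p y‖ := by linarith
    rw [ker, norm_div, norm_one, norm_mul]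
    calc _ ≤ 1 / (‖p y‖ * ‖p y + 1‖) * ((2 * ‖p y + 1‖) * Y ^ (-e) / Real.log Y) := by
          refine mul_le_mul_of_nonneg_left (h1.trans ?_) (by positivity)
          gcongr
          linarith
      _ = 2 * (Y ^ (-e) / (Real.log Y * ‖p y‖)) := by field_simp
      _ ≤ _ := by rw [hQ]; gcongr
  have hAk' : ∀ y ∈ Icc a (a+1), ‖-(2 * p y + 1) / (p y * (p y + 1)) ^ 2‖ * ‖Af Y H (p y)‖ ≤ 4 * Q := by
    intro y hy
    have h1 := Af_le hY hY1 hH he.le (hre y) (hp1 y hy)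
    have h2 := hnp y hy
    have h3 := hnp1 y hy
    have h30 : 0 < ‖p y + 1‖ := by linarith
    have h20 : 0 < ‖p y‖ := by linarith
    have h4 : ‖2 * p y + 1‖ ≤ ‖p y‖ + ‖p y + 1‖ := by
      rw [show 2 * p y + 1 = p y + (p y + 1) by ring]; exact norm_add_le _ _
    have h5 : ‖p y‖ + ‖p y + 1‖ ≤ 2 * (‖p y‖ * ‖p y + 1‖) := by nlinarith
    rw [norm_div, norm_neg, norm_pow, norm_mul]
    calc _ ≤ 2 * (‖p y‖ * ‖p y + 1‖) / (‖p y‖ * ‖p y + 1‖) ^ 2 * ((2 * ‖p y + 1‖) * Y ^ (-e) / Real.log Y) := by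
          refine mul_le_mul ?_ (h1.trans ?_) (norm_nonneg _) (by positivity)
          · gcongr
            exact h4.trans h5
          · gcongr
            linarith
      _ = 4 * (Y ^ (-e) / (Real.log Y * ‖p y‖)) := by field_simp; norm_num
      _ ≤ _ := by rw [hQ]; gcongr
  set G : ℝ → ℂ := fun y => LD χ σ - LD χ (σ + p y) with hG
  have hGd : ∀ y ∈ Icc a (a+1), HasDerivAt G (-(deriv (LD χ) (σ + p y) * I)) y := by
    intro y hy
    have hd : HasDerivAt (LD χ) (deriv (LD χ) (σ + p y)) (σ + p y) :=
      ((LD_diff hχ _ (hL y hy)).differentiableAt ((L_open hχ).mem_nhds (hL y hy))).hasDerivAt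
    have := (hd.comp y ((hpd y).const_add (σ:ℂ))).const_sub (LD χ σ)
    exact this
  set u : ℝ → ℂ := fun y => G y * ker (p y) with hu
  set u' : ℝ → ℂ := fun y => -(deriv (LD χ) (σ + p y) * I) * ker (p y) + G y * (-(2 * p y + 1) / (p y * (p y + 1)) ^ 2 * I) with hu'
  set v : ℝ → ℂ := fun y => -I * Af Y H (p y) with hv
  set v' : ℝ → ℂ := fun y => Bf Y H (p y) with hv'
  have hud : ∀ y ∈ uIcc a (a+1), HasDerivAt u (u' y) y := by
    intro y hy
    rw [uIcc_of_le hab] at hy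
    exact (hGd y hy).mul ((ker_hasDeriv (hp0 y hy) (hp1 y hy)).comp y (hpd y))
  have hvd : ∀ y ∈ uIcc a (a+1), HasDerivAt v (v' y) y := by
    intro y _
    have := ((Af_deriv hY1 hH (p y)).comp y (hpd y)).const_mul (-I)
    refine this.congr_deriv ?_
    simp only [hv']
    linear_combination (-(Bf Y H (p y))) * I_mul_I
  have hpc : Continuous p := by fun_prop
  have hdc : ContinuousOn (fun y => deriv (LD χ) (σ + p y)) (Icc a (a+1)) := by
    have : ContinuousOn (deriv (LD χ)) {s | DirichletCharacter.LFunction χ s ≠ 0} :=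
      ((LD_diff hχ).deriv (L_open hχ)).continuousOn
    exact this.comp (f := fun y : ℝ => (σ + p y : ℂ)) (by fun_prop) (fun t ht => hL t ht)
  have hGc : ContinuousOn G (Icc a (a+1)) := fun y hy => (hGd y hy).continuousAt.continuousWithinAt
  have hkc : ContinuousOn (fun y => ker (p y)) (Icc a (a+1)) := fun y hy =>
    ((ker_hasDeriv (hp0 y hy) (hp1 y hy)).comp y (hpd y)).continuousAt.continuousWithinAt
  have hkc' : ContinuousOn (fun y => -(2 * p y + 1) / (p y * (p y + 1)) ^ 2 * I) (Icc a (a+1)) := by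
    refine ContinuousOn.mul (ContinuousOn.div (by fun_prop) (by fun_prop) ?_) continuousOn_const
    intro y hy
    exact pow_ne_zero _ (mul_ne_zero (hp0 y hy) (hp1 y hy))
  have hu'c : ContinuousOn u' (Icc a (a+1)) :=
    (((hdc.mul continuousOn_const).neg).mul hkc).add (hGc.mul hkc')
  have hv'c : Continuous v' := (Bf_diff hY0 hH).continuous.comp hpc
  have hibp := intervalIntegral.integral_mul_deriv_eq_deriv_mul hud hvd
    (by apply ContinuousOn.intervalIntegrable; rw [uIcc_of_le hab]; exact hu'c) (hv'c.intervalIntegrable _ _)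
  have hPhi : ∫ y in a..a+1, Phi χ σ Y H ((-e:ℝ) + y * I) = ∫ y in a..a+1, u y * v' y := by
    congr 1; ext y
    simp only [hu, hv', hG, Phi, sker_eq]
    ring
  rw [hPhi, hibp]
  have hbd : ∀ y ∈ Icc a (a+1), ‖u y * v y‖ ≤ 2 * S * Q := by
    intro y hy
    simp only [hu, hv, norm_mul, norm_neg, norm_I, one_mul]
    calc _ = ‖G y‖ * (‖ker (p y)‖ * ‖Af Y H (p y)‖) := by ring
      _ ≤ S * (2 * Q) := mul_le_mul (hS y hy) (hAk y hy) (by positivity) hS0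
      _ = _ := by ring
  have hIntg : ‖∫ y in a..a+1, u' y * v y‖ ≤ 6 * S * Q := by
    have hdi : IntervalIntegrable (fun y => ‖deriv (LD χ) (σ + p y)‖) volume a (a+1) := by
      apply ContinuousOn.intervalIntegrable; rw [uIcc_of_le hab]; exact hdc.norm
    have : ‖∫ y in a..a+1, u' y * v y‖ ≤ ∫ y in a..a+1, (‖deriv (LD χ) (σ + p y)‖ * (2 * Q) + 4 * S * Q) := by
      apply intervalIntegral.norm_integral_le_of_norm_le hab
      · filter_upwards with y hy
        have hy' : y ∈ Icc a (a+1) := ⟨hy.1.le, hy.2⟩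
        simp only [hu', hv]
        rw [norm_mul, norm_mul, norm_neg, norm_I, one_mul]
        have h1 := hAk y hy'
        have h2 := hAk' y hy'
        calc _ ≤ (‖deriv (LD χ) (σ + p y)‖ * ‖ker (p y)‖ + ‖G y‖ * ‖-(2 * p y + 1) / (p y * (p y + 1)) ^ 2‖) * ‖Af Y H (p y)‖ := by
              gcongr
              refine (norm_add_le _ _).trans (le_of_eq ?_)
              rw [norm_mul, norm_neg, norm_mul, norm_I, mul_one, norm_mul, norm_mul, norm_I, mul_one]
          _ = ‖deriv (LD χ) (σ + p y)‖ * (‖ker (p y)‖ * ‖Af Y H (p y)‖) + ‖G y‖ * (‖-(2 * p y + 1) / (p y * (p y + 1)) ^ 2‖ * ‖Af Y H (p y)‖) := by ring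
          _ ≤ ‖deriv (LD χ) (σ + p y)‖ * (2 * Q) + S * (4 * Q) := by
              refine add_le_add (mul_le_mul_of_nonneg_left h1 (norm_nonneg _)) (mul_le_mul (hS y hy') h2 (by positivity) hS0)
          _ = _ := by ring
      · exact (hdi.mul_const _).add intervalIntegrable_const
    rw [intervalIntegral.integral_add (hdi.mul_const _) intervalIntegrable_const, intervalIntegral.integral_mul_const] at this
    simp only [intervalIntegral.integral_const, add_sub_cancel_left, one_smul] at this
    calc _ ≤ _ := this
      _ ≤ S * (2 * Q) + 4 * S * Q := by gcongr
      _ = _ := by ring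
  calc _ ≤ ‖u (a+1) * v (a+1)‖ + ‖u a * v a‖ + ‖∫ y in a..a+1, u' y * v y‖ :=
        (norm_sub_le _ _).trans (by gcongr; exact norm_sub_le _ _)
    _ ≤ 2 * S * Q + 2 * S * Q + 6 * S * Q := by
        gcongr
        · exact hbd _ ⟨hab, le_rfl⟩
        · exact hbd _ ⟨le_rfl, hab⟩
    _ = _ := by ring

lemma middle {q : ℕ} [NeZero q] {χ : DirichletCharacter ℂ q} {σ Y H e S : ℝ}
    (hY : 2 ≤ Y) (hH : 0 < H) (he : 0 < e) (he1 : e < 1)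
    (hS : ∀ y ∈ Icc (-1:ℝ) 1, ‖LD χ σ - LD χ (σ + ((-e:ℝ) + y * I))‖ ≤ S) :
    ‖∫ y in (-1:ℝ)..1, Phi χ σ Y H ((-e:ℝ) + y * I)‖ ≤ 4 * S * Y ^ (-e) * Real.log (Y / e) := by
  have hS0 : 0 ≤ S := (norm_nonneg _).trans (hS 0 (by simp))
  have hY0 : 0 < Y := by linarith
  have hYe : 0 ≤ Y ^ (-e) := by positivity
  have hgc : Continuous (fun y : ℝ => 2 / (e + |y|)) := by
    refine continuous_const.div (by fun_prop) ?_
    intro y; positivity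
  have h1 : ‖∫ y in (-1:ℝ)..1, Phi χ σ Y H ((-e:ℝ) + y * I)‖ ≤ ∫ y in (-1:ℝ)..1, S * Y ^ (-e) * (2 / (e + |y|)) := by
    apply intervalIntegral.norm_integral_le_of_norm_le (by norm_num)
    · filter_upwards with y hy
      set w : ℂ := (-e:ℝ) + y * I with hw
      have hre : w.re = -e := by simp [hw]
      have him : w.im = y := by simp [hw]
      have hw1 : w + 1 ≠ 0 := by
        intro h; have := congrArg re h; rw [add_re, hre] at this; simp at this; linarith
      have hw0 : e + |y| ≤ 2 * ‖w‖ := by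
        have a1 := abs_re_le_norm w
        have a2 := abs_im_le_norm w
        rw [hre, abs_neg, abs_of_pos he] at a1
        rw [him] at a2
        linarith
      have hey : 0 < e + |y| := by positivity
      have hwn : 0 < ‖w‖ := by linarith
      have hw1n : 0 < ‖w + 1‖ := norm_pos_iff.mpr hw1
      have hB := Bf_le hY0 hH he.le hre hw1
      rw [Phi, sker_eq, norm_mul, norm_mul, ker, norm_div, norm_one, norm_mul, mul_assoc]
      refine mul_le_mul (hS y ⟨hy.1.le, hy.2⟩) ?_ (by positivity) hS0
      calc _ ≤ ‖w + 1‖ * Y ^ (-e) * (1 / (‖w‖ * ‖w + 1‖)) := by gcongr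
        _ = Y ^ (-e) * (2 / (2 * ‖w‖)) := by field_simp
        _ ≤ _ := by gcongr
    · exact (continuous_const.mul hgc).intervalIntegrable _ _
  rw [intervalIntegral.integral_const_mul] at h1
  have h3 : ∫ y in (0:ℝ)..1, 2 / (e + |y|) ≤ 2 * Real.log (Y / e) := by
    have : ∫ y in (0:ℝ)..1, 2 / (e + |y|) = 2 * Real.log (e + 1) - 2 * Real.log (e + 0) := by
      apply intervalIntegral.integral_eq_sub_of_hasDerivAt (f := fun y => 2 * Real.log (e + y))
      · intro y hy
        rw [uIcc_of_le zero_le_one] at hy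
        rw [abs_of_nonneg hy.1]
        have hne : e + y ≠ 0 := by linarith [hy.1]
        have := (((hasDerivAt_id y).const_add e).log hne).const_mul 2
        refine this.congr_deriv ?_
        simp only [id]; ring
      · exact hgc.intervalIntegrable _ _
    rw [this, add_zero, Real.log_div hY0.ne' he.ne']
    have : Real.log (e + 1) ≤ Real.log Y := Real.log_le_log (by linarith) (by linarith)
    linarith
  have h4 : ∫ y in (-1:ℝ)..0, 2 / (e + |y|) = ∫ y in (0:ℝ)..1, 2 / (e + |y|) := by
    have := intervalIntegral.integral_comp_neg (a := 0) (b := 1) (fun y : ℝ => 2 / (e + |y|))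
    simp only [abs_neg, neg_zero] at this
    exact this.symm
  have h2 : ∫ y in (-1:ℝ)..1, 2 / (e + |y|) ≤ 4 * Real.log (Y / e) := by
    rw [← intervalIntegral.integral_add_adjacent_intervals (hgc.intervalIntegrable (-1) 0) (hgc.intervalIntegrable 0 1), h4]
    linarith
  calc _ ≤ _ := h1
    _ ≤ S * Y ^ (-e) * (4 * Real.log (Y / e)) := by gcongr
    _ = _ := by ring

end LDA

namespace LDA
open Complex Metric MeasureTheory Set Filter Asymptotics

lemma log_three_ge : (1:ℝ) ≤ Real.log 3 := by
  rw [Real.le_log_iff_exp_le (by norm_num)]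
  have := Real.exp_one_lt_d9
  linarith

lemma smooth_sum {Y σ : ℝ} (hY : 3 ≤ Y) (hσ : 0 ≤ σ) :
    ∑ n ∈ Finset.Ioc ⌊Y⌋₊ ⌊Y + √Y⌋₊, ArithmeticFunction.vonMangoldt n / (n:ℝ) ^ σ ≤ 4 * (Y ^ (1/2 - σ) * Real.log Y) := by
  have hY0 : 0 < Y := by linarith
  have hsq : √Y * √Y = Y := Real.mul_self_sqrt hY0.le
  have hs1 : 1 ≤ √Y := Real.one_le_sqrt.mpr (by linarith)
  have hsY : √Y ≤ Y := by nlinarith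
  have hl0 : 0 ≤ Real.log Y := Real.log_nonneg (by linarith)
  have hterm : ∀ n ∈ Finset.Ioc ⌊Y⌋₊ ⌊Y + √Y⌋₊, ArithmeticFunction.vonMangoldt n / (n:ℝ) ^ σ ≤ 2 * Real.log Y / Y ^ σ := by
    intro n hn
    rw [Finset.mem_Ioc] at hn
    have h1 : Y < n := (Nat.floor_lt hY0.le).mp hn.1
    have h2 : (n:ℝ) ≤ Y + √Y := (Nat.le_floor_iff (by positivity)).mp hn.2
    have h3 : Real.log n ≤ 2 * Real.log Y := by
      rw [show 2 * Real.log Y = Real.log (Y^2) by rw [Real.log_pow]; norm_num]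
      apply Real.log_le_log (by linarith)
      nlinarith
    calc _ ≤ 2 * Real.log Y / (n:ℝ) ^ σ := by
          gcongr
          exact ArithmeticFunction.vonMangoldt_le_log.trans h3
      _ ≤ _ := by gcongr
  refine (Finset.sum_le_card_nsmul _ _ _ hterm).trans ?_
  rw [nsmul_eq_mul, Nat.card_Ioc]
  have hcard : ((⌊Y + √Y⌋₊ - ⌊Y⌋₊ : ℕ) : ℝ) ≤ 2 * √Y := by
    rw [Nat.cast_sub (Nat.floor_mono (by linarith))]
    have h1 := Nat.floor_le (show 0 ≤ Y + √Y by positivity)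
    have h2 := Nat.lt_floor_add_one Y
    linarith
  calc _ ≤ 2 * √Y * (2 * Real.log Y / Y ^ σ) := by gcongr
    _ = _ := by
      rw [Real.rpow_sub hY0, ← Real.sqrt_eq_rpow]; ring

lemma sker_coarse {Y σ c : ℝ} (hY : 3 ≤ Y) (hσ : 1/2 ≤ σ) (hc : c = 1 - σ + 1 / Real.log Y) {w : ℂ}
    (hw : -1 ≤ w.re) (hw' : w.re ≤ c) (him : w.im ≠ 0) :
    ‖sker Y (√Y) w‖ ≤ 48 * (Y ^ (1/2 - σ) * Y) / w.im ^ 2 := by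
  have hY0 : 0 < Y := by linarith
  have hsq : √Y * √Y = Y := Real.mul_self_sqrt hY0.le
  have hs1 : 1 ≤ √Y := Real.one_le_sqrt.mpr (by linarith)
  have hs0 : 0 < √Y := by linarith
  have hsY : √Y ≤ Y := by nlinarith
  have hl1 : 1 ≤ Real.log Y := log_three_ge.trans (Real.log_le_log (by norm_num) hY)
  have hl0 : 0 < Real.log Y := by linarith
  have hc2 : c + 1 ≤ 3 := by
    have : 1 / Real.log Y ≤ 1 := by rw [div_le_one hl0]; exact hl1
    linarith
  have hpow : ∀ x : ℝ, 0 < x → x ≤ 2 * Y → ‖(x:ℂ) ^ (w + 1)‖ ≤ 24 * Y ^ (2 - σ) := by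
    intro x hx hx2
    rw [norm_cpow_eq_rpow_re_of_pos hx, add_re, one_re]
    calc x ^ (w.re + 1) ≤ (2 * Y) ^ (w.re + 1) := Real.rpow_le_rpow hx.le hx2 (by linarith)
      _ ≤ (2 * Y) ^ (c + 1) := Real.rpow_le_rpow_of_exponent_le (by linarith) (by linarith)
      _ = 2 ^ (c + 1) * (Y ^ (2 - σ) * Real.exp 1) := by
          rw [Real.mul_rpow (by norm_num) hY0.le]
          congr 1
          rw [hc, show 1 - σ + 1 / Real.log Y + 1 = (2 - σ) + 1 / Real.log Y by ring, Real.rpow_add hY0]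
          congr 1
          rw [Real.rpow_def_of_pos hY0]
          congr 1
          field_simp
      _ ≤ 2 ^ (3:ℝ) * (Y ^ (2 - σ) * 3) := by
          have := Real.exp_one_lt_d9
          gcongr
          · norm_num
          · linarith
      _ = _ := by norm_num; ring
  have hB : ‖Bf Y (√Y) w‖ ≤ 48 * (Y ^ (1/2 - σ) * Y) := by
    rw [Bf, norm_div, norm_real, Real.norm_of_nonneg hs0.le, div_le_iff₀ hs0]
    have h1 := hpow (Y + √Y) (by linarith) (by linarith)
    have h2 := hpow Y hY0 (by linarith)
    have e1 : Y ^ (1/2 - σ) * Y * √Y = Y ^ (2 - σ) := by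
      rw [Real.sqrt_eq_rpow]
      nth_rewrite 2 [← Real.rpow_one Y]
      rw [← Real.rpow_add hY0, ← Real.rpow_add hY0]
      congr 1; ring
    calc _ ≤ _ := norm_sub_le _ _
      _ ≤ 48 * Y ^ (2 - σ) := by linarith
      _ = _ := by rw [← e1]; ring
  have hk : ‖ker w‖ ≤ 1 / w.im ^ 2 := by
    rw [ker, norm_div, norm_one, norm_mul]
    apply one_div_le_one_div_of_le (by positivity)
    have h1 := abs_im_le_norm w
    have h2 := abs_im_le_norm (w + 1)
    rw [add_im, one_im, add_zero] at h2
    rw [← sq_abs, sq]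
    gcongr
  rw [sker_eq, norm_mul]
  calc _ ≤ 48 * (Y ^ (1/2 - σ) * Y) * (1 / w.im ^ 2) := by gcongr
    _ = _ := by ring

end LDA

open DirichletCharacter

set_option maxHeartbeats 4000000 in
/-- Let `q ≥ 3`, `Y ≥ 3`, and `χ` a nonprincipal Dirichlet character mod `q`. Suppose the
rectangle `{z : σ₀ < Re z ≤ 1, |Im z| ≤ Y + 2}` contains no zeros of `L(·, χ)`, where
`1/2 ≤ σ₀ < 1`. Then for `σ ∈ (σ₀, 1]` and `σ₁ ∈ (σ₀, σ)`,
`−L'/L(σ,χ) = ∑_{n ≤ Y} Λ(n)χ(n)/n^σ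
  + O((log q/(σ₁ − σ₀))·Y^{σ₁−σ}·log(Y/(σ − σ₁)))` with an absolute implied constant. -/
theorem log_deriv_L_approx :
    ∃ C : ℝ, 0 < C ∧ ∀ (q : ℕ) [NeZero q], 3 ≤ q → ∀ Y : ℝ, 3 ≤ Y →
      ∀ χ : DirichletCharacter ℂ q, χ ≠ 1 →
      ∀ σ₀ σ σ₁ : ℝ, 1 / 2 ≤ σ₀ → σ₀ < 1 →
      (∀ z : ℂ, σ₀ < z.re → z.re ≤ 1 → |z.im| ≤ Y + 2 → LFunction χ z ≠ 0) →
      σ₀ < σ → σ ≤ 1 → σ₀ < σ₁ → σ₁ < σ →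
      ‖-(deriv (LFunction χ) σ / LFunction χ σ) -
          ∑ n ∈ Finset.Icc 1 ⌊Y⌋₊,
            (ArithmeticFunction.vonMangoldt n : ℂ) * χ n / (n : ℂ) ^ (σ : ℂ)‖ ≤
        C * (Real.log q / (σ₁ - σ₀)) * Y ^ (σ₁ - σ) * Real.log (Y / (σ - σ₁)) := by
  obtain ⟨C1, hC1, hpt⟩ := LDA.ptwise
  obtain ⟨C2, hC2, hbl⟩ := LDA.block
  refine ⟨4 + 192 * (2 * C1 + 6) + 768 * (5 * C1 + 3 * C2) + 16 * C1 + 40 * (5 * C1 + 3 * C2), by positivity, ?_⟩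
  intro q _ hq Y hY χ hχ σ₀ σ σ₁ hσ₀ hσ₀1 hz hσ hσ1 hσ₁ hσ₁σ
  -- basic quantities
  have hq' : (3:ℝ) ≤ q := by exact_mod_cast hq
  have hY0 : 0 < Y := by linarith
  set u := σ₁ - σ₀ with hu
  set e := σ - σ₁ with he
  have hu0 : 0 < u := by linarith
  have hu1 : u ≤ 1 := by linarith
  have he0 : 0 < e := by linarith
  have he1 : e ≤ 1/2 := by linarith
  have hne : σ₁ - σ = -e := by rw [he]; ring
  rw [hne]
  set Lq := Real.log q with hLq
  set l := Real.log Y with hl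
  have hLq1 : 1 ≤ Lq := LDA.log_three_ge.trans (Real.log_le_log (by norm_num) hq')
  have hl1 : 1 ≤ l := LDA.log_three_ge.trans (Real.log_le_log (by norm_num) hY)
  have hl0 : 0 < l := by linarith
  have hLq0 : 0 < Lq := by linarith
  have hlogY2 : ∀ t : ℝ, |t| ≤ Y → Real.log (q * (|t| + 2)) ≤ 3 * Lq * l := by
    intro t ht
    have ht0 := abs_nonneg t
    have h1 : Real.log (|t| + 2) ≤ 2 * l := by
      rw [show 2 * l = Real.log (Y^2) by rw [Real.log_pow, hl]; norm_num]
      apply Real.log_le_log (by linarith)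
      nlinarith
    rw [Real.log_mul (by positivity) (by positivity)]
    nlinarith
  have hlog1 : ∀ t : ℝ, |t| ≤ 1 → Real.log (q * (|t| + 2)) ≤ 2 * Lq := by
    intro t ht
    have ht0 := abs_nonneg t
    rw [show 2 * Lq = Real.log ((q:ℝ)^2) by rw [Real.log_pow, hLq]; norm_num]
    apply Real.log_le_log (by positivity)
    nlinarith
  have hLD1 : ∀ s : ℂ, σ₁ ≤ s.re → s.re ≤ 2 → |s.im| ≤ Y → ‖LDA.LD χ s‖ ≤ 3 * C1 * (Lq * l / u) := by
    intro s h1 h2 h3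
    calc _ ≤ C1 * Real.log (q * (|s.im| + 2)) / u := hpt q hq χ hχ σ₀ Y u hσ₀ hz hu0 hu1 s (by linarith) h2 h3
      _ ≤ C1 * (3 * Lq * l) / u := by gcongr; exact hlogY2 _ h3
      _ = _ := by ring
  have hLD2 : ∀ s : ℂ, σ₁ ≤ s.re → s.re ≤ 2 → |s.im| ≤ 1 → ‖LDA.LD χ s‖ ≤ 2 * C1 * (Lq / u) := by
    intro s h1 h2 h3
    calc _ ≤ C1 * Real.log (q * (|s.im| + 2)) / u := hpt q hq χ hχ σ₀ Y u hσ₀ hz hu0 hu1 s (by linarith) h2 (by linarith)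
      _ ≤ C1 * (2 * Lq) / u := by gcongr; exact hlog1 _ h3
      _ = _ := by ring
  have hLDσ : ‖LDA.LD χ σ‖ ≤ 2 * C1 * (Lq / u) := hLD2 σ (by simp; linarith) (by simp; linarith) (by simp)
  set P := Lq * l / u with hP
  have hP0 : 0 < P := by positivity
  have hLqP : Lq / u ≤ P := by
    rw [hP]; gcongr; nlinarith
  set S := (5 * C1 + 3 * C2) * P with hS
  have hS0 : 0 < S := by positivity
  have hG : ∀ w : ℂ, -e ≤ w.re → σ + w.re ≤ 2 → |w.im| ≤ Y → ‖LDA.LD χ σ - LDA.LD χ (σ + w)‖ ≤ S := by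
    intro w h1 h2 h3
    have := hLD1 (σ + w) (by simp; linarith) (by simpa using h2) (by simpa using h3)
    calc _ ≤ _ := norm_sub_le _ _
      _ ≤ 2 * C1 * (Lq / u) + 3 * C1 * P := add_le_add hLDσ this
      _ ≤ 2 * C1 * P + 3 * C1 * P + 3 * C2 * P := by
          have : 0 ≤ 3 * C2 * P := by positivity
          have : 2 * C1 * (Lq / u) ≤ 2 * C1 * P := by gcongr
          linarith
      _ = _ := by rw [hS]; ring
  -- the target size
  set R := Y ^ (-e) with hR
  have hR0 : 0 < R := by positivity
  set lam := Real.log (Y / e) with hlam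
  have hlaml : l ≤ lam := by
    apply Real.log_le_log hY0
    rw [le_div_iff₀ he0]; nlinarith
  set X := Lq / u * R * lam with hX
  have hX1 : P * R ≤ X := by
    calc P * R = Lq / u * R * l := by rw [hP]; ring
      _ ≤ _ := by rw [hX]; gcongr
  set Z := Y ^ (1/2 - σ) with hZ
  have hZ0 : 0 < Z := by positivity
  have hZR : Z * l ≤ R / u := by
    have e1 : R = Z * Y ^ (σ₁ - 1/2) := by
      rw [hR, hZ, ← Real.rpow_add hY0]; congr 1; rw [he]; ring
    rw [le_div_iff₀ hu0, e1, mul_assoc]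
    gcongr
    calc l * u ≤ Real.exp (l * u) := by linarith [Real.add_one_le_exp (l * u)]
      _ = Y ^ u := by rw [Real.rpow_def_of_pos hY0]
      _ ≤ _ := Real.rpow_le_rpow_of_exponent_le (by linarith) (by linarith)
  have hZR2 : Z ≤ R := by
    apply Real.rpow_le_rpow_of_exponent_le (by linarith); linarith
  have hX2 : Z * l ^ 2 ≤ X := by
    calc Z * l ^ 2 = 1 * (Z * l) * l := by ring
      _ ≤ Lq * (R / u) * lam := by gcongr
      _ = X := by rw [hX]; ring
  have hX3 : Z * (Lq / u) ≤ X := by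
    calc Z * (Lq / u) ≤ R * P := by gcongr
      _ ≤ X := by rw [mul_comm]; exact hX1
  have hX0 : 0 < X := lt_of_lt_of_le (by positivity) hX1
  -- parameters
  set H := √Y with hH
  have hH0 : 0 < H := Real.sqrt_pos.mpr hY0
  set c := 1 - σ + 1 / l with hc
  have hl' : 0 < 1 / l := by positivity
  have hl'1 : 1 / l ≤ 1 := by rw [div_le_one hl0]; exact hl1
  have hc0 : 0 < c := by linarith
  set N := ⌊Y⌋₊ with hN
  have hN1 : 1 ≤ N := Nat.le_floor (by simp; linarith)
  have hNY : (N:ℝ) ≤ Y := Nat.floor_le hY0.le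
  have hNY2 : Y / 2 ≤ N := by have := Nat.lt_floor_add_one Y; linarith
  have hN0 : (0:ℝ) < N := by linarith
  obtain ⟨hIntg, hmain⟩ := LDA.perron_main χ (σ := σ) (c := c) (Y := Y) (H := H) hc0 (by linarith) (by linarith) hH0
  refine (show _ ≤ _ from hmain).trans ?_
  have hsm : ∑ n ∈ Finset.Ioc ⌊Y⌋₊ ⌊Y + H⌋₊, ArithmeticFunction.vonMangoldt n / (n:ℝ) ^ σ ≤ 4 * X := by
    refine (LDA.smooth_sum hY (by linarith)).trans ?_
    have : Z * l ≤ Z * l^2 := by gcongr; nlinarith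
    linarith
  -- tail
  have htail := LDA.tail_bound hIntg hN0 (D := (2 * C1 * (Lq / u) + 6 * l ^ 2) * (48 * (Z * Y))) (by
    intro y hy
    have hy0 : y ≠ 0 := by
      intro h; rw [h, abs_zero] at hy; linarith
    have h1 := LDA.sker_coarse hY (by linarith : 1/2 ≤ σ) (c := c) rfl (w := c + y * Complex.I) (by simp; linarith) (by simp) (by simpa using hy0)
    have him : (c + y * Complex.I : ℂ).im = y := by simp
    rw [him] at h1
    have h2 : ‖LDA.LD χ (σ + (c + y * Complex.I))‖ ≤ 6 * l ^ 2 := by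
      have := LDA.LD_right χ hl' hl'1 (s := σ + (c + y * Complex.I)) (by simp only [Complex.add_re, Complex.ofReal_re, Complex.mul_re, Complex.I_re, Complex.I_im, Complex.ofReal_im]; rw [hc]; ring)
      refine this.trans (le_of_eq ?_)
      field_simp
    rw [norm_mul]
    calc _ ≤ (2 * C1 * (Lq / u) + 6 * l ^ 2) * (48 * (Z * Y) / y ^ 2) := by
          refine mul_le_mul ((norm_sub_le _ _).trans (add_le_add hLDσ h2)) h1 (norm_nonneg _) (by positivity)
      _ = _ := by ring)
  have htail2 : 2 * ((2 * C1 * (Lq / u) + 6 * l ^ 2) * (48 * (Z * Y)) / N) ≤ 192 * (2 * C1 + 6) * X := by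
    calc _ ≤ 2 * ((2 * C1 * (Lq / u) + 6 * l ^ 2) * (48 * (Z * Y)) / (Y / 2)) := by gcongr
      _ = 192 * (2 * C1 * (Z * (Lq / u)) + 6 * (Z * l ^ 2)) := by field_simp; ring
      _ ≤ 192 * (2 * C1 * X + 6 * X) := by gcongr
      _ = _ := by ring
  -- contour
  have hLne : ∀ w : ℂ, -e ≤ w.re → |w.im| ≤ (N:ℝ) → LFunction χ (σ + w) ≠ 0 := by
    intro w h1 h2
    exact LDA.L_ne hχ hz (by simp; linarith) (by simp; linarith)
  have hcont := LDA.contour hχ (σ := σ) hY0 hH0 he0 (by linarith) hc0 hN0 hLne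
  have hhor : ∀ t : ℝ, |t| = N → ‖∫ x in (-e)..c, LDA.Phi χ σ Y H (x + t * Complex.I)‖ ≤ 384 * (5 * C1 + 3 * C2) * X := by
    intro t ht
    have ht0 : t ≠ 0 := by intro h; rw [h, abs_zero] at ht; linarith
    have hb : ∀ x ∈ Set.uIoc (-e) c, ‖LDA.Phi χ σ Y H (x + t * Complex.I)‖ ≤ S * (48 * (Z * Y) / (Y / 2) ^ 2) := by
      intro x hx
      rw [Set.uIoc_of_le (by linarith)] at hx
      have h1 := LDA.sker_coarse hY (by linarith : 1/2 ≤ σ) (c := c) rfl (w := x + t * Complex.I) (by simp; linarith [hx.1]) (by simpa using hx.2) (by simpa using ht0)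
      have him : (x + t * Complex.I : ℂ).im = t := by simp
      rw [him, ← sq_abs, ht] at h1
      have h2 := hG (x + t * Complex.I) (by simpa using hx.1.le) (by simp; linarith [hx.2]) (by rw [him, ht]; exact hNY)
      rw [LDA.Phi, norm_mul]
      refine mul_le_mul h2 (h1.trans ?_) (norm_nonneg _) hS0.le
      gcongr
    have := intervalIntegral.norm_integral_le_of_norm_le_const hb
    refine this.trans ?_
    have hce : |c - -e| ≤ 2 := by rw [abs_of_pos (by linarith)]; linarith
    calc _ ≤ S * (48 * (Z * Y) / (Y / 2) ^ 2) * 2 := by gcongr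
      _ = 384 * S * (Z / Y) := by field_simp; ring
      _ ≤ 384 * S * R := by
          gcongr
          calc Z / Y ≤ Z := div_le_self hZ0.le (by linarith)
            _ ≤ R := hZR2
      _ = 384 * (5 * C1 + 3 * C2) * (P * R) := by rw [hS]; ring
      _ ≤ _ := by gcongr
  have hh1 := hhor (-N) (by rw [abs_neg, abs_of_pos hN0])
  have hh2 := hhor N (abs_of_pos hN0)
  -- left line
  have hmid := LDA.middle (χ := χ) (σ := σ) (H := H) (S := 4 * C1 * (Lq / u)) (by linarith : 2 ≤ Y) hH0 he0 (by linarith) (by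
    intro y hy
    have := hLD2 (σ + (((-e:ℝ):ℂ) + y * Complex.I)) (by simp; linarith) (by simp; linarith) (by simpa using abs_le.mpr hy)
    calc _ ≤ _ := norm_sub_le _ _
      _ ≤ 2 * C1 * (Lq / u) + 2 * C1 * (Lq / u) := add_le_add hLDσ this
      _ = _ := by ring)
  have hmid2 : 4 * (4 * C1 * (Lq / u)) * Y ^ (-e) * Real.log (Y / e) = 16 * C1 * X := by
    rw [hX]; ring
  rw [hmid2] at hmid
  have hline : ∀ y : ℝ, (σ:ℂ) + (((-e:ℝ):ℂ) + y * Complex.I) = σ₁ + y * Complex.I := by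
    intro y; rw [he]; push_cast; ring
  have hblk : ∀ (k : ℕ) (a : ℝ), 1 ≤ k → (∀ y ∈ Set.Icc a (a+1), (k:ℝ) ≤ |y| ∧ |y| ≤ N) →
      ‖∫ y in a..a+1, LDA.Phi χ σ Y H ((-e:ℝ) + y * Complex.I)‖ ≤ (10 * S * (R / l)) / k := by
    intro k a hk hya
    have hk' : (1:ℝ) ≤ k := by exact_mod_cast hk
    have := LDA.ibp_block hχ (σ := σ) (Y := Y) (H := H) (e := e) (a := a) (m := k) (S := S) hl1 (by linarith) hH0 he0 hk'
      (fun y hy => (hya y hy).1)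
      (fun y hy => hLne _ (by simp) (by simpa using (hya y hy).2))
      (fun y hy => hG _ (by simp) (by simp; linarith) (by simpa using (hya y hy).2.trans hNY))
      (by
        simp_rw [hline]
        have haY : |a| ≤ Y := (hya a ⟨le_rfl, by linarith⟩).2.trans hNY
        calc _ ≤ C2 * Real.log (q * (|a| + 2)) / u := hbl q hq χ hχ σ₀ Y u hσ₀ hz hu0 hu1 σ₁ (by linarith) (by linarith) a (fun t ht => (hya t ht).2.trans hNY)
          _ ≤ C2 * (3 * Lq * l) / u := by gcongr; exact hlogY2 a haY
          _ = 3 * C2 * P := by rw [hP]; ring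
          _ ≤ S := by
            rw [hS]
            have : 0 ≤ 5 * C1 * P := by positivity
            linarith)
    refine this.trans (le_of_eq ?_)
    rw [← hR, ← hl]
    field_simp
  have hleft := LDA.line_split (f := fun y : ℝ => LDA.Phi χ σ Y H ((-e:ℝ) + y * Complex.I)) hN1 (D := 10 * S * (R / l)) (by positivity)
    (by
      intro y hy
      have hw0 : (((-e:ℝ):ℂ) + y * Complex.I) ≠ 0 := by
        intro h; have := congrArg Complex.re h; simp at this; linarith
      have hw1 : (((-e:ℝ):ℂ) + y * Complex.I) + 1 ≠ 0 := by
        intro h; have := congrArg Complex.re h; simp at this; linarith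
      have hpc : ContinuousAt (fun y : ℝ => ((-e:ℝ):ℂ) + y * Complex.I) y := by fun_prop
      have hLn := hLne (((-e:ℝ):ℂ) + y * Complex.I) (by simp) (by simpa using abs_le.mpr hy)
      have hLc : ContinuousAt (LDA.LD χ) ((σ:ℂ) + (((-e:ℝ):ℂ) + y * Complex.I)) :=
        ((LDA.LD_diff hχ _ hLn).differentiableAt ((LDA.L_open hχ).mem_nhds hLn)).continuousAt
      have hPc : ContinuousAt (LDA.Phi χ σ Y H) (((-e:ℝ):ℂ) + y * Complex.I) := by
        have h3 : LDA.Phi χ σ Y H = fun w => (LDA.LD χ σ - LDA.LD χ (σ + w)) * (LDA.Bf Y H w * LDA.ker w) := by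
          funext w; rw [LDA.Phi, LDA.sker_eq]
        rw [h3]
        refine ContinuousAt.mul (continuousAt_const.sub ?_) (((LDA.Bf_diff hY0 hH0) _).continuousAt.mul (LDA.ker_hasDeriv hw0 hw1).continuousAt)
        exact ContinuousAt.comp (f := fun w : ℂ => (σ:ℂ) + w) hLc (by fun_prop)
      exact (ContinuousAt.comp (f := fun y : ℝ => ((-e:ℝ):ℂ) + y * Complex.I) hPc hpc).continuousWithinAt)
    (by
      intro k hk hkN
      apply hblk k k hk
      intro y hy
      have hkN' : ((k+1:ℕ):ℝ) ≤ N := by exact_mod_cast hkN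
      push_cast at hkN'
      have hk0 : (0:ℝ) ≤ k := by positivity
      rw [abs_of_nonneg (by linarith [hy.1])]
      exact ⟨hy.1, by linarith [hy.2]⟩)
    (by
      intro k hk hkN
      apply hblk k (-(k+1)) hk
      intro y hy
      have hkN' : ((k+1:ℕ):ℝ) ≤ N := by exact_mod_cast hkN
      push_cast at hkN'
      have hk0 : (0:ℝ) ≤ k := by positivity
      have h1 := hy.1
      have h2 := hy.2
      rw [abs_of_nonpos (by linarith)]
      exact ⟨by linarith, by linarith⟩)
  have hleft2 : 2 * (10 * S * (R / l)) * (1 + Real.log N) ≤ 40 * (5 * C1 + 3 * C2) * X := by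
    have hlN : Real.log N ≤ l := Real.log_le_log hN0 hNY
    calc _ ≤ 2 * (10 * S * (R / l)) * (2 * l) := by gcongr; linarith
      _ = 40 * (5 * C1 + 3 * C2) * (P * R) := by rw [hS]; field_simp; ring
      _ ≤ _ := by gcongr
  -- assembling
  have hpi : (1:ℝ) ≤ 2 * Real.pi := by have := Real.pi_gt_three; linarith
  have hfin : ‖∫ y : ℝ, (LDA.LD χ σ - LDA.LD χ (σ + (c + y * Complex.I))) * LDA.sker Y H (c + y * Complex.I)‖
      ≤ (192 * (2 * C1 + 6) + 768 * (5 * C1 + 3 * C2) + 16 * C1 + 40 * (5 * C1 + 3 * C2)) * X := by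
    unfold LDA.Phi at hcont hh1 hh2 hmid hleft
    push_cast at hcont hh1 hh2 hmid hleft htail ⊢
    linarith
  have hdiv := (div_le_self (norm_nonneg (∫ y : ℝ, (LDA.LD χ σ - LDA.LD χ (σ + (c + y * Complex.I))) * LDA.sker Y H (c + y * Complex.I))) hpi).trans hfin
  calc _ ≤ _ := add_le_add hdiv hsm
    _ = _ := by rw [hX]; ring
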